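/- Distance-to-boundary weight in a Boman domain: let 1 < p ≤ q ≤ np/(n−p) < ∞, set β = n − (q/p)(n−p), and let Ω ⊂ ℝ^n be a bounded Boman domain with constant N ≥ 1 such that the weight w(x) = d(x,∂Ω)^{−β} is doubling in Ω with constant D. Then there is a constant C = C(n, p, q, D, N) > 0 such that for every u ∈ Lip_loc(Ω), inf_{c∈ℝ} (∫_Ω |u(x) − c|^q d(x,∂Ω)^{−n+(q/p)(n−p)} dx)^{1/q} ≤ C (∫_Ω |∇u(x)|^p dx)^{1/p}. -/

import Mathlib

open MeasureTheory ENNReal NNReal Set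

noncomputable section

/-- Euclidean space `ℝ^n`. -/
abbrev Rn (n : ℕ) := EuclideanSpace ℝ (Fin n)

/-- The half-open cube `Q(x, r)` with midpoint `x` and side length `2r`. -/
def CubeC {n : ℕ} (x : Rn n) (r : ℝ) : Set (Rn n) :=
  {y | ∀ i, x i - r ≤ y i ∧ y i < x i + r}

/-- The weighted measure `w(E) = ∫_E w dx` of a set, as an extended nonnegative real. -/
def wMass {n : ℕ} (w : Rn n → ℝ) (E : Set (Rn n)) : ℝ≥0∞ :=
  ∫⁻ x in E, ENNReal.ofReal (w x)

/-- The measure `w dx`. -/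
def wMeasure {n : ℕ} (w : Rn n → ℝ) : Measure (Rn n) :=
  volume.withDensity fun x => ENNReal.ofReal (w x)

/-- The weighted average `u_{w;E} = w(E)⁻¹ ∫_E u w dx`. -/
def wAvg {n : ℕ} (w : Rn n → ℝ) (E : Set (Rn n)) (u : Rn n → ℝ) : ℝ :=
  ⨍ x in E, u x ∂(wMeasure w)

/-- A weight `w` is doubling in the open set `Ω` with constant `D`:
`w(Ω ∩ Q(x,2r)) ≤ D w(Ω ∩ Q(x,r))` for every cube `Q(x,r)` with midpoint `x ∈ Ω`. -/
def DoublingIn {n : ℕ} (Ω : Set (Rn n)) (w : Rn n → ℝ) (D : ℝ) : Prop :=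
  ∀ x ∈ Ω, ∀ r : ℝ, 0 < r →
    wMass w (Ω ∩ CubeC x (2 * r)) ≤ ENNReal.ofReal D * wMass w (Ω ∩ CubeC x r)

/-- The distance between two sets. -/
def setDist {n : ℕ} (A B : Set (Rn n)) : ℝ :=
  sInf {d : ℝ | ∃ x ∈ A, ∃ y ∈ B, d = dist x y}

/-- A Whitney decomposition of `Ω` with dimensional constant `Cdim`: a countable family of
pairwise disjoint half-open cubes covering `Ω`, such that the side length of each dilated
cube `Q* = (9/8)Q` is comparable (with constant `Cdim`) to its distance from `∂Ω`, and the
dilated cubes have overlap bounded by `Cdim`. -/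
structure WhitneyDecomp (n : ℕ) (Ω : Set (Rn n)) (Cdim : ℝ) where
  cubes : Set (Set (Rn n))
  countable : cubes.Countable
  center : Set (Rn n) → Rn n
  radius : Set (Rn n) → ℝ
  radius_pos : ∀ Q ∈ cubes, 0 < radius Q
  eq_cube : ∀ Q ∈ cubes, Q = CubeC (center Q) (radius Q)
  pairwise_disjoint : cubes.PairwiseDisjoint id
  union_eq : ⋃₀ cubes = Ω
  dist_lower : ∀ Q ∈ cubes,
    9 / 4 * radius Q ≤ Cdim * setDist (CubeC (center Q) (9 / 8 * radius Q)) (frontier Ω)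
  dist_upper : ∀ Q ∈ cubes,
    setDist (CubeC (center Q) (9 / 8 * radius Q)) (frontier Ω) ≤ Cdim * (9 / 4 * radius Q)
  overlap_finite : ∀ x : Rn n, {Q ∈ cubes | x ∈ CubeC (center Q) (9 / 8 * radius Q)}.Finite
  overlap_le : ∀ x : Rn n,
    (({Q ∈ cubes | x ∈ CubeC (center Q) (9 / 8 * radius Q)}).ncard : ℝ) ≤ Cdim

/-- The dilated Whitney cube `Q* = (9/8)Q`. -/
def Qstar {n : ℕ} {Ω : Set (Rn n)} {Cdim : ℝ} (W : WhitneyDecomp n Ω Cdim)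
    (Q : Set (Rn n)) : Set (Rn n) :=
  CubeC (W.center Q) (9 / 8 * W.radius Q)

/-- Two Whitney cubes `P, Q` are chained (with constant `c`) if there is a cube
`R ⊆ P* ∩ Q*` with `l(R) ≥ c · max{l(P*), l(Q*)}`. -/
def ChainLink {n : ℕ} {Ω : Set (Rn n)} {Cdim : ℝ} (W : WhitneyDecomp n Ω Cdim) (c : ℝ)
    (P Q : Set (Rn n)) : Prop :=
  ∃ (z : Rn n) (r : ℝ), 0 < r ∧ CubeC z r ⊆ Qstar W P ∩ Qstar W Q ∧
    c * max (2 * (9 / 8 * W.radius P)) (2 * (9 / 8 * W.radius Q)) ≤ 2 * r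

/-- `L` is a chain of Whitney cubes joining `P` to `Q`: a list of distinct Whitney cubes
starting at `P`, ending at `Q`, whose consecutive members are chained. -/
def IsChainFrom {n : ℕ} {Ω : Set (Rn n)} {Cdim : ℝ} (W : WhitneyDecomp n Ω Cdim) (c : ℝ)
    (P Q : Set (Rn n)) (L : List (Set (Rn n))) : Prop :=
  (∀ R ∈ L, R ∈ W.cubes) ∧ L.Nodup ∧ L.head? = some P ∧ L.getLast? = some Q ∧
    L.Chain' (ChainLink W c)

/-- A Boman chain decomposition of `Ω` with constants `Cdim` (Whitney), `cdim` (chain link)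
and `N` (Boman): a Whitney decomposition together with a chain decomposition with common
central cube such that the shadow of each `R` is contained in `NR`. -/
structure BomanDecomp (n : ℕ) (Ω : Set (Rn n)) (Cdim cdim N : ℝ)
    extends WhitneyDecomp n Ω Cdim where
  central : Set (Rn n)
  central_mem : central ∈ cubes
  chain : Set (Rn n) → List (Set (Rn n))
  chain_isChain : ∀ Q ∈ cubes, IsChainFrom toWhitneyDecomp cdim central Q (chain Q)
  shadow_subset : ∀ R ∈ cubes, ∀ Q ∈ cubes, R ∈ chain Q →
    Q ⊆ CubeC (center R) (N * radius R)

theorem rpow_lintegral_le_lintegral_rpow {α : Type*} [MeasurableSpace α] (ν : Measure α)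
    [IsProbabilityMeasure ν] {p : ℝ} (hp : 1 ≤ p) {f : α → ℝ≥0∞} (hf : AEMeasurable f ν) :
    (∫⁻ a, f a ∂ν) ^ p ≤ ∫⁻ a, f a ^ p ∂ν := by
  have h := eLpNorm_le_eLpNorm_of_exponent_le (μ := ν) (f := f) (p := 1) (q := ENNReal.ofReal p)
    (by simpa using hp) hf.aestronglyMeasurable
  have hp0 : 0 < p := by linarith
  rw [eLpNorm_one_eq_lintegral_enorm, eLpNorm_eq_lintegral_rpow_enorm_toReal (by simpa using hp0)
    (by simp), ENNReal.toReal_ofReal hp0.le] at h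
  simp only [enorm_eq_self] at h
  calc (∫⁻ a, f a ∂ν) ^ p ≤ ((∫⁻ a, f a ^ p ∂ν) ^ (1 / p)) ^ p := by gcongr
    _ = _ := by rw [← ENNReal.rpow_mul, one_div_mul_cancel hp0.ne', ENNReal.rpow_one]

section Haar

variable {E : Type*} [NormedAddCommGroup E] [NormedSpace ℝ E] [FiniteDimensional ℝ E]
  [MeasurableSpace E] [BorelSpace E] (μ : Measure E) [μ.IsAddHaarMeasure]

theorem lintegral_comp_smul_add (F : E → ℝ≥0∞) {t : ℝ} (ht : t ≠ 0) (b : E) :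
    ∫⁻ x, F (t • x + b) ∂μ = ENNReal.ofReal |(t ^ Module.finrank ℝ E)⁻¹| * ∫⁻ x, F x ∂μ := by
  have h1 : MeasurableEmbedding (fun x : E => t • x) :=
    (Homeomorph.smulOfNeZero t ht).measurableEmbedding
  have h2 := h1.lintegral_map (μ := μ) (fun x => F (x + b))
  rw [← h2, Measure.map_addHaar_smul μ ht, lintegral_smul_measure, lintegral_add_right_eq_self]
  rfl

theorem enorm_sub_rpow_le_lintegral_segment {E : Type*} [NormedAddCommGroup E]
    [NormedSpace ℝ E] {g : E → ℝ} (hg : ContDiff ℝ 1 g) {p : ℝ}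
    (hp : 1 ≤ p) (x y : E) :
    ‖g x - g y‖ₑ ^ p ≤
      ‖x - y‖ₑ ^ p * ∫⁻ t in Ioc (0 : ℝ) 1, ‖fderiv ℝ g (y + t • (x - y))‖ₑ ^ p := by
  have hp0 : 0 < p := by linarith
  have hc : Continuous fun t : ℝ => fderiv ℝ g (y + t • (x - y)) :=
    (hg.continuous_fderiv one_ne_zero).comp (by fun_prop)
  have hd : ∀ t : ℝ, HasDerivAt (fun t : ℝ => g (y + t • (x - y)))
      (fderiv ℝ g (y + t • (x - y)) (x - y)) t := by
    intro t
    have h1 : HasDerivAt (fun t : ℝ => y + t • (x - y)) (x - y) t := by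
      simpa using ((hasDerivAt_id t).smul_const (x - y)).const_add y
    exact ((hg.differentiable one_ne_zero _).hasFDerivAt).comp_hasDerivAt t h1
  have hc' : Continuous fun t : ℝ => fderiv ℝ g (y + t • (x - y)) (x - y) :=
    hc.clm_apply continuous_const
  have hftc := intervalIntegral.integral_eq_sub_of_hasDerivAt (fun t _ => hd t)
    (hc'.intervalIntegrable 0 1)
  simp only [one_smul, zero_smul, add_zero, add_sub_cancel] at hftc
  rw [← hftc, intervalIntegral.integral_of_le zero_le_one]
  have hprob : IsProbabilityMeasure (volume.restrict (Ioc (0 : ℝ) 1)) := ⟨by simp⟩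
  calc ‖∫ t in Ioc (0 : ℝ) 1, fderiv ℝ g (y + t • (x - y)) (x - y)‖ₑ ^ p
      ≤ (∫⁻ t in Ioc (0 : ℝ) 1, ‖fderiv ℝ g (y + t • (x - y)) (x - y)‖ₑ) ^ p := by
        gcongr; exact enorm_integral_le_lintegral_enorm _
    _ ≤ ∫⁻ t in Ioc (0 : ℝ) 1, ‖fderiv ℝ g (y + t • (x - y)) (x - y)‖ₑ ^ p :=
        rpow_lintegral_le_lintegral_rpow _ hp hc'.enorm.aemeasurable
    _ ≤ ∫⁻ t in Ioc (0 : ℝ) 1, ‖x - y‖ₑ ^ p * ‖fderiv ℝ g (y + t • (x - y))‖ₑ ^ p := by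
        gcongr with t
        rw [← ENNReal.mul_rpow_of_nonneg _ _ hp0.le, mul_comm]
        gcongr
        exact ContinuousLinearMap.le_opENorm _ _
    _ = _ := by
        rw [lintegral_const_mul]
        exact (hc.enorm.measurable.pow_const _)

/-- `(p, p)`-Poincaré inequality on bounded convex sets, in double-integral form. -/
theorem lintegral_lintegral_enorm_sub_rpow_le {K : Set E} (hK : Convex ℝ K)
    (hKm : MeasurableSet K) {d : ℝ≥0∞} (hd : ∀ x ∈ K, ∀ y ∈ K, ‖x - y‖ₑ ≤ d) {g : E → ℝ}
    (hg : ContDiff ℝ 1 g) {p : ℝ} (hp : 1 ≤ p) :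
    ∫⁻ y in K, ∫⁻ x in K, ‖g x - g y‖ₑ ^ p ∂μ ∂μ ≤
      d ^ p * (2 ^ Module.finrank ℝ E * μ K * ∫⁻ x in K, ‖fderiv ℝ g x‖ₑ ^ p ∂μ) := by
  have hp0 : 0 < p := by linarith
  set F : E → ℝ≥0∞ := K.indicator fun z => ‖fderiv ℝ g z‖ₑ ^ p with hF
  have hFm : Measurable F :=
    ((hg.continuous_fderiv one_ne_zero).enorm.measurable.pow_const _).indicator hKm
  have hFi : ∫⁻ z, F z ∂μ = ∫⁻ x in K, ‖fderiv ℝ g x‖ₑ ^ p ∂μ := lintegral_indicator hKm _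
  have hpt : ∀ y ∈ K, ∀ x ∈ K, ‖g x - g y‖ₑ ^ p ≤
      d ^ p * ∫⁻ t in Ioc (0 : ℝ) 1, F (y + t • (x - y)) := by
    intro y hy x hx
    refine (enorm_sub_rpow_le_lintegral_segment hg hp x y).trans ?_
    gcongr ?_ ^ p * ?_
    · exact hd x hx y hy
    refine (setLIntegral_congr_fun measurableSet_Ioc fun t ht => ?_).le
    rw [hF, indicator_of_mem]
    exact hK.add_smul_sub_mem hy hx ⟨ht.1.le, ht.2⟩
  have hjm : Measurable fun q : (E × E) × ℝ => F (q.1.1 + q.2 • (q.1.2 - q.1.1)) :=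
    hFm.comp (by fun_prop)
  have hscale : ∀ t : ℝ, 1 / 2 ≤ t →
      ENNReal.ofReal |(t ^ Module.finrank ℝ E)⁻¹| ≤ 2 ^ Module.finrank ℝ E := by
    intro t ht
    have ht0 : 0 < t := by linarith
    rw [abs_of_pos (by positivity), ← inv_pow, ENNReal.ofReal_pow (by positivity)]
    gcongr
    rw [← ENNReal.ofReal_ofNat 2]
    refine ENNReal.ofReal_le_ofReal ?_
    rw [inv_le_comm₀ ht0 (by norm_num)]; linarith
  have hbound : ∀ t : ℝ, ∫⁻ y in K, ∫⁻ x in K, F (y + t • (x - y)) ∂μ ∂μ ≤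
      2 ^ Module.finrank ℝ E * μ K * ∫⁻ z, F z ∂μ := by
    intro t
    have key : ∀ (s : ℝ), 1 / 2 ≤ s → ∀ b : E, ∫⁻ x in K, F (s • x + b) ∂μ ≤
        2 ^ Module.finrank ℝ E * ∫⁻ z, F z ∂μ := by
      intro s hs b
      refine (setLIntegral_le_lintegral _ _).trans ?_
      rw [lintegral_comp_smul_add μ F (by linarith : s ≠ 0)]
      gcongr
      exact hscale s hs
    have fin : ∀ {s : ℝ} {b : E → E}, 1 / 2 ≤ s →
        ∫⁻ y in K, ∫⁻ x in K, F (s • x + b y) ∂μ ∂μ ≤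
          2 ^ Module.finrank ℝ E * μ K * ∫⁻ z, F z ∂μ := by
      intro s b hs
      calc _ ≤ ∫⁻ y in K, 2 ^ Module.finrank ℝ E * ∫⁻ z, F z ∂μ ∂μ :=
            lintegral_mono fun y => key s hs (b y)
        _ = _ := by rw [setLIntegral_const]; ring
    rcases le_total (1 / 2) t with ht | ht
    · refine le_of_eq_of_le ?_ (fin (s := t) (b := fun y => (1 - t) • y) ht)
      refine lintegral_congr fun y => lintegral_congr fun x => congrArg F ?_
      module
    · rw [lintegral_lintegral_swap]
      · refine le_of_eq_of_le ?_ (fin (s := 1 - t) (b := fun y => t • y) (by linarith))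
        refine lintegral_congr fun y => lintegral_congr fun x => congrArg F ?_
        module
      · exact (hFm.comp (by fun_prop)).aemeasurable
  calc ∫⁻ y in K, ∫⁻ x in K, ‖g x - g y‖ₑ ^ p ∂μ ∂μ
      ≤ ∫⁻ y in K, ∫⁻ x in K, d ^ p * (∫⁻ t in Ioc (0 : ℝ) 1, F (y + t • (x - y))) ∂μ ∂μ :=
        setLIntegral_mono' hKm fun y hy => setLIntegral_mono' hKm fun x hx => hpt y hy x hx
    _ = d ^ p * ∫⁻ y in K, ∫⁻ x in K, (∫⁻ t in Ioc (0 : ℝ) 1, F (y + t • (x - y))) ∂μ ∂μ := by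
        rw [← lintegral_const_mul]
        · refine lintegral_congr fun y => ?_
          rw [lintegral_const_mul]
          exact (hFm.comp (by fun_prop : Measurable fun q : E × ℝ =>
            y + q.2 • (q.1 - y))).lintegral_prod_right'
        · exact Measurable.lintegral_prod_right' (f := fun q : E × E =>
            ∫⁻ t in Ioc (0 : ℝ) 1, F (q.1 + t • (q.2 - q.1))) hjm.lintegral_prod_right'
    _ = d ^ p * ∫⁻ t in Ioc (0 : ℝ) 1, ∫⁻ y in K, ∫⁻ x in K, F (y + t • (x - y)) ∂μ ∂μ := by
        congr 1
        have : ∀ y, ∫⁻ x in K, (∫⁻ t in Ioc (0 : ℝ) 1, F (y + t • (x - y))) ∂μ =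
            ∫⁻ t in Ioc (0 : ℝ) 1, ∫⁻ x in K, F (y + t • (x - y)) ∂μ := fun y =>
          lintegral_lintegral_swap (hFm.comp (by fun_prop)).aemeasurable
        simp_rw [this]
        refine lintegral_lintegral_swap (Measurable.aemeasurable ?_)
        exact Measurable.lintegral_prod_right' (f := fun q : (E × ℝ) × E =>
          F (q.1.1 + q.1.2 • (q.2 - q.1.1))) (hFm.comp (by fun_prop))
    _ ≤ d ^ p * ∫⁻ t in Ioc (0 : ℝ) 1, 2 ^ Module.finrank ℝ E * μ K * ∫⁻ z, F z ∂μ := by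
        gcongr with t
        exact hbound t
    _ = _ := by simp [hFi]

end Haar

section Cube

variable {n : ℕ}

theorem cubeC_eq_preimage (x : Rn n) (r : ℝ) :
    CubeC x r = WithLp.ofLp ⁻¹' (univ.pi fun i => Ico (x i - r) (x i + r)) := by
  ext y; simp [CubeC, Set.mem_pi]

theorem measurableSet_cubeC (x : Rn n) (r : ℝ) : MeasurableSet (CubeC x r) := by
  rw [cubeC_eq_preimage]
  exact (PiLp.volume_preserving_ofLp (Fin n)).measurable
    (MeasurableSet.univ_pi fun i => measurableSet_Ico)

theorem volume_cubeC (x : Rn n) (r : ℝ) : volume (CubeC x r) = ENNReal.ofReal (2 * r) ^ n := by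
  rw [cubeC_eq_preimage, (PiLp.volume_preserving_ofLp (Fin n)).measure_preimage
    (MeasurableSet.univ_pi fun i => measurableSet_Ico).nullMeasurableSet, Real.volume_pi_Ico]
  simp only [Finset.prod_const, Finset.card_univ, Fintype.card_fin,
    show ∀ i, x i + r - (x i - r) = 2 * r from fun i => by ring]

theorem convex_cubeC (x : Rn n) (r : ℝ) : Convex ℝ (CubeC x r) := by
  rw [cubeC_eq_preimage]
  exact (convex_pi fun i _ => convex_Ico _ _).linear_preimage
    (WithLp.linearEquiv 2 ℝ (Fin n → ℝ)).toLinearMap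

theorem mem_cubeC_self (x : Rn n) {r : ℝ} (hr : 0 < r) : x ∈ CubeC x r :=
  fun i => ⟨by linarith, by linarith⟩

theorem cubeC_subset_cubeC (x : Rn n) {r s : ℝ} (h : r ≤ s) : CubeC x r ⊆ CubeC x s :=
  fun y hy i => ⟨by linarith [(hy i).1], by linarith [(hy i).2]⟩

theorem cubeC_trans {x y z : Rn n} {r s : ℝ} (hy : y ∈ CubeC x r) (hz : z ∈ CubeC y s) :
    z ∈ CubeC x (r + s) :=
  fun i => ⟨by linarith [(hy i).1, (hz i).1], by linarith [(hy i).2, (hz i).2]⟩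

theorem abs_sub_le_dist (x y : Rn n) (i : Fin n) : |x i - y i| ≤ dist x y := by
  rw [dist_eq_norm, ← Real.norm_eq_abs]
  exact PiLp.norm_apply_le (x - y) i

theorem dist_le_of_abs_sub_le {x y : Rn n} {r : ℝ} (hr : 0 ≤ r) (h : ∀ i, |x i - y i| ≤ r) :
    dist x y ≤ n * r := by
  rw [EuclideanSpace.dist_eq]
  refine Real.sqrt_le_iff.2 ⟨by positivity, ?_⟩
  calc ∑ i, dist (x i) (y i) ^ 2 ≤ ∑ _i : Fin n, r ^ 2 := by
        refine Finset.sum_le_sum fun i _ => ?_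
        rw [Real.dist_eq]
        exact pow_le_pow_left₀ (abs_nonneg _) (h i) 2
    _ = n * r ^ 2 := by simp
    _ ≤ (n * r) ^ 2 := by
        rw [mul_pow]
        gcongr
        exact_mod_cast Nat.le_self_pow two_ne_zero n

theorem dist_le_of_mem_cubeC {x y : Rn n} {r : ℝ} (hr : 0 ≤ r) (h : y ∈ CubeC x r) :
    dist y x ≤ n * r :=
  dist_le_of_abs_sub_le hr fun i => abs_le.2
    ⟨by linarith [(h i).1], by linarith [(h i).2]⟩

theorem mem_cubeC_of_dist_lt {x y : Rn n} {r : ℝ} (h : dist y x < r) : y ∈ CubeC x r :=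
  fun i => by
    have := abs_le.1 (abs_sub_le_dist y x i)
    exact ⟨by linarith, by linarith⟩

theorem cubeC_subset_closedBall (x : Rn n) {r : ℝ} (hr : 0 ≤ r) :
    CubeC x r ⊆ Metric.closedBall x (n * r) :=
  fun _ hy => dist_le_of_mem_cubeC hr hy

theorem smul_add_mem_cubeC_iff {x y : Rn n} {r s : ℝ} (hs : 0 < s) :
    s • y + x ∈ CubeC x (s * r) ↔ y ∈ CubeC 0 r := by
  simp only [CubeC, Set.mem_ofPred_eq, PiLp.add_apply, PiLp.smul_apply, smul_eq_mul, PiLp.zero_apply]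
  refine forall_congr' fun i => and_congr ?_ ?_
  · constructor <;> intro h <;> nlinarith
  · constructor <;> intro h <;> nlinarith

end Cube

section

open scoped Manifold

theorem enorm_sub_rpow_le_two_rpow_mul {q : ℝ} (hq : 1 ≤ q) (a b c : ℝ) :
    ‖a - b‖ₑ ^ q ≤ 2 ^ (q - 1) * (‖a - c‖ₑ ^ q + ‖b - c‖ₑ ^ q) := by
  refine le_trans ?_ (ENNReal.rpow_add_le_mul_rpow_add_rpow _ _ hq)
  have : a - b = (a - c) - (b - c) := by ring
  rw [this]
  gcongr
  exact enorm_sub_le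

theorem exists_smooth_cutoff_cubeC (n : ℕ) {l : ℝ} (hl : 1 < l) :
    ∃ η : Rn n → ℝ, ContDiff ℝ 1 η ∧ (∀ x, ‖η x‖ₑ ≤ 1) ∧ (∀ x ∈ CubeC 0 1, η x = 1) ∧
      (∀ x ∉ CubeC 0 l, η x = 0) ∧ (∀ x ∉ CubeC 0 l, fderiv ℝ η x = 0) ∧
      ∃ M : ℝ≥0, ∀ x, ‖fderiv ℝ η x‖ₑ ≤ M := by
  have hcont : ∀ i : Fin n, Continuous fun x : Rn n => |x i| := fun i =>
    continuous_abs.comp (EuclideanSpace.proj i).continuous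
  have hs : IsClosed (⋃ i, {x : Rn n | l ≤ |x i|}) :=
    isClosed_iUnion_of_finite fun i => isClosed_le continuous_const (hcont i)
  have ht : IsClosed (⋂ i, {x : Rn n | |x i| ≤ 1}) :=
    isClosed_iInter fun i => isClosed_le (hcont i) continuous_const
  have hd : Disjoint (⋃ i, {x : Rn n | l ≤ |x i|}) (⋂ i, {x : Rn n | |x i| ≤ 1}) := by
    rw [Set.disjoint_left]
    intro x hx hx'
    obtain ⟨i, hi⟩ := mem_iUnion.1 hx
    have h1 : |x i| ≤ 1 := mem_iInter.1 hx' i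
    have h2 : l ≤ |x i| := hi
    linarith
  obtain ⟨η, hη, hr, h0, h1⟩ :=
    exists_contMDiff_zero_iff_one_iff_of_isClosed (n := 1) 𝓘(ℝ, Rn n) hs ht hd
  have hη' : ContDiff ℝ 1 η := contMDiff_iff_contDiff.1 hη
  have hrange : ∀ x, 0 ≤ η x ∧ η x ≤ 1 := fun x => hr (mem_range_self x)
  have hzero : ∀ x ∉ CubeC 0 l, η x = 0 := by
    intro x hx
    rw [← h0]
    by_contra hcon
    refine hx fun i => ?_
    have : ¬ l ≤ |x i| := fun h => hcon (mem_iUnion.2 ⟨i, h⟩)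
    have := abs_lt.1 (not_le.1 this)
    simp only [PiLp.zero_apply]
    exact ⟨by linarith, by linarith⟩
  have hfd : ∀ x ∉ CubeC 0 l, fderiv ℝ η x = 0 := by
    intro x hx
    refine IsLocalMin.fderiv_eq_zero (Filter.Eventually.of_forall fun y => ?_)
    change η x ≤ η y
    rw [hzero x hx]
    exact (hrange y).1
  have hcs : HasCompactSupport (fderiv ℝ η) := by
    refine HasCompactSupport.intro (K := Metric.closedBall 0 (n * l))
      (isCompact_closedBall _ _) fun x hx => hfd x fun hx' => hx ?_
    exact cubeC_subset_closedBall _ (by linarith) hx'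
  obtain ⟨M, hM⟩ := (hη'.continuous_fderiv one_ne_zero).bounded_above_of_compact_support hcs
  refine ⟨η, hη', fun x => ?_, fun x hx => ?_, hzero, hfd, M.toNNReal, fun x => ?_⟩
  · rw [Real.enorm_of_nonneg (hrange x).1]
    simpa using (hrange x).2
  · refine (h1 x).1 (mem_iInter.2 fun i => ?_)
    have := hx i
    simp only [PiLp.zero_apply] at this
    change |x i| ≤ 1
    rw [abs_le]
    exact ⟨by linarith [this.1], by linarith [this.2]⟩
  · rw [← ofReal_norm]
    exact ENNReal.ofReal_le_ofReal (hM x)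

/-- Sobolev–Poincaré inequality on the unit cube for `C^1` functions. -/
theorem exists_sobolev_poincare_unit_of_contDiff (n : ℕ) {p q l : ℝ} (hp : 1 < p) (hpq : p ≤ q)
    (hpn : p < n) (hq : q ≤ n * p / (n - p)) (hl : 1 < l) :
    ∃ C : ℝ≥0, ∀ g : Rn n → ℝ, ContDiff ℝ 1 g →
      ∫⁻ y in CubeC 0 1, ∫⁻ x in CubeC 0 1, ‖g x - g y‖ₑ ^ q ≤
        C * (∫⁻ x in CubeC (0 : Rn n) l, ‖fderiv ℝ g x‖ₑ ^ p) ^ (q / p) := by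
  have hp0 : 0 < p := by linarith
  have hq0 : 0 < q := by linarith
  have hl0 : 0 < l := by linarith
  have hn : 0 < (n : ℝ) := by linarith
  obtain ⟨η, hη, hη1, hηone, hηzero, hηfd, M, hM⟩ := exists_smooth_cutoff_cubeC n hl
  set K : Set (Rn n) := CubeC 0 1
  set K' : Set (Rn n) := CubeC 0 l with hK'
  have hKm : MeasurableSet K := measurableSet_cubeC _ _
  have hKm' : MeasurableSet K' := measurableSet_cubeC _ _
  have hvol' : volume K' ≠ 0 := by
    rw [hK', volume_cubeC]; exact pow_ne_zero _ (by simpa using hl0)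
  have hvolt' : volume K' ≠ ⊤ := by
    rw [hK', volume_cubeC]; exact ENNReal.pow_ne_top ENNReal.ofReal_ne_top
  have hvolt : volume K ≠ ⊤ := by
    rw [volume_cubeC]; exact ENNReal.pow_ne_top ENNReal.ofReal_ne_top
  have hbdd : Bornology.IsBounded K' :=
    (Metric.isBounded_closedBall).subset (cubeC_subset_closedBall _ hl0.le)
  set d : ℝ≥0 := (2 * (n * l)).toNNReal with hd
  have hdK : ∀ x ∈ K', ∀ y ∈ K', ‖x - y‖ₑ ≤ d := by
    intro x hx y hy
    rw [← ofReal_norm, ← dist_eq_norm]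
    refine ENNReal.ofReal_le_ofReal ?_
    linarith [dist_triangle_right x y 0, dist_le_of_mem_cubeC hl0.le hx,
      dist_le_of_mem_cubeC hl0.le hy]
  set S : ℝ≥0 := eLpNormLESNormFDerivOfLeConst ℝ (volume : Measure (Rn n)) K' p.toNNReal q.toNNReal
  set C₁ : ℝ≥0∞ := (volume K')⁻¹ * ((d : ℝ≥0∞) ^ p *
    (2 ^ Module.finrank ℝ (Rn n) * volume K')) with hC₁
  have hC₁t : C₁ ≠ ⊤ := by
    have : (volume K')⁻¹ ≠ ⊤ := by simpa using hvol'
    have : (d : ℝ≥0∞) ^ p ≠ ⊤ := by finiteness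
    finiteness
  set C₂ : ℝ≥0∞ := 2 ^ (p - 1) * (1 + (M : ℝ≥0∞) ^ p * C₁) with hC₂
  have hC₂t : C₂ ≠ ⊤ := by
    have : (M : ℝ≥0∞) ^ p ≠ ⊤ := by finiteness
    finiteness
  set C₃ : ℝ≥0∞ := 2 ^ (q - 1) * (2 * volume K) * ((S : ℝ≥0∞) * C₂ ^ (1 / p)) ^ q with hC₃
  have hC₃t : C₃ ≠ ⊤ := by
    have h1 : C₂ ^ (1 / p) ≠ ⊤ := by finiteness
    have : ((S : ℝ≥0∞) * C₂ ^ (1 / p)) ^ q ≠ ⊤ :=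
      ENNReal.rpow_ne_top_of_nonneg hq0.le (by finiteness)
    finiteness
  refine ⟨C₃.toNNReal, fun g hg => ?_⟩
  rw [ENNReal.coe_toNNReal hC₃t]
  set A : ℝ≥0∞ := ∫⁻ x in K', ‖fderiv ℝ g x‖ₑ ^ p with hA
  have hpoin := lintegral_lintegral_enorm_sub_rpow_le (volume : Measure (Rn n))
    (convex_cubeC 0 l) hKm' hdK hg hp.le
  have hgm := hg.continuous.measurable
  obtain ⟨y₀, -, hy₀⟩ : ∃ y ∈ K', ∫⁻ x in K', ‖g x - g y‖ₑ ^ p ≤ C₁ * A := by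
    obtain ⟨y, hy, hle⟩ := exists_le_setLAverage (μ := volume)
      (f := fun y => ∫⁻ x in K', ‖g x - g y‖ₑ ^ p) hvol' hvolt' (by
        refine Measurable.aemeasurable ?_
        exact Measurable.lintegral_prod_right' (f := fun z : Rn n × Rn n => ‖g z.2 - g z.1‖ₑ ^ p)
          (by fun_prop))
    refine ⟨y, hy, hle.trans ?_⟩
    rw [setLAverage_eq, ENNReal.div_eq_inv_mul]
    calc _ ≤ (volume K')⁻¹ * ((d : ℝ≥0∞) ^ p *
          (2 ^ Module.finrank ℝ (Rn n) * volume K' * A)) := by gcongr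
      _ = _ := by rw [hC₁]; ring
  set c := g y₀
  set h : Rn n → ℝ := fun x => η x * (g x - c) with hh
  have hhd : ContDiff ℝ 1 h := hη.mul (hg.sub contDiff_const)
  have hsupp : h.support ⊆ K' := by
    intro x hx
    by_contra hcon
    exact hx (by simp [hh, hηzero x hcon])
  have hfd : ∀ x, fderiv ℝ h x = η x • fderiv ℝ g x + (g x - c) • fderiv ℝ η x := by
    intro x
    have h1 := (hη.differentiable one_ne_zero x).hasFDerivAt
    have h2 := ((hg.differentiable one_ne_zero x).hasFDerivAt).sub_const c
    exact (h1.mul h2).fderiv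
  have hgrad : ∫⁻ x, ‖fderiv ℝ h x‖ₑ ^ p ≤ C₂ * A := by
    have hpt : ∀ x, ‖fderiv ℝ h x‖ₑ ^ p ≤ K'.indicator (fun x => 2 ^ (p - 1) *
        (‖fderiv ℝ g x‖ₑ ^ p + (M : ℝ≥0∞) ^ p * ‖g x - c‖ₑ ^ p)) x := by
      intro x
      by_cases hx : x ∈ K'
      · rw [indicator_of_mem hx, hfd]
        calc ‖η x • fderiv ℝ g x + (g x - c) • fderiv ℝ η x‖ₑ ^ p
            ≤ (‖fderiv ℝ g x‖ₑ + M * ‖g x - c‖ₑ) ^ p := by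
              gcongr
              have htri : ‖η x • fderiv ℝ g x + (g x - c) • fderiv ℝ η x‖ₑ ≤
                  ‖η x • fderiv ℝ g x‖ₑ + ‖(g x - c) • fderiv ℝ η x‖ₑ := by
                simp only [← ofReal_norm]
                rw [← ENNReal.ofReal_add (norm_nonneg _) (norm_nonneg _)]
                exact ENNReal.ofReal_le_ofReal (norm_add_le _ _)
              refine htri.trans ?_
              rw [enorm_smul, enorm_smul, mul_comm ‖g x - c‖ₑ]
              gcongr
              · exact mul_le_of_le_one_left zero_le (hη1 x)
              · exact hM x
          _ ≤ _ := by
              refine (ENNReal.rpow_add_le_mul_rpow_add_rpow _ _ hp.le).trans ?_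
              rw [ENNReal.mul_rpow_of_nonneg _ _ hp0.le]
      · have : fderiv ℝ h x = 0 := by rw [hfd, hηzero x hx, hηfd x hx]; simp
        simp [← ofReal_norm, this, hp0]
    calc _ ≤ ∫⁻ x in K', 2 ^ (p - 1) *
          (‖fderiv ℝ g x‖ₑ ^ p + (M : ℝ≥0∞) ^ p * ‖g x - c‖ₑ ^ p) := by
          rw [← lintegral_indicator hKm']
          exact lintegral_mono hpt
      _ = 2 ^ (p - 1) * (A + (M : ℝ≥0∞) ^ p * ∫⁻ x in K', ‖g x - c‖ₑ ^ p) := by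
          rw [lintegral_const_mul' _ _ (by finiteness), lintegral_add_right _ (by fun_prop),
            lintegral_const_mul' _ _ (by finiteness)]
      _ ≤ 2 ^ (p - 1) * (A + (M : ℝ≥0∞) ^ p * (C₁ * A)) := by gcongr
      _ = C₂ * A := by rw [hC₂]; ring
  have hsob := eLpNorm_le_eLpNorm_fderiv_of_le (volume : Measure (Rn n)) hhd hsupp
    (p := p.toNNReal) (q := q.toNNReal) (by rw [← NNReal.coe_le_coe]; simp [hp0.le, hp.le])
    (by rw [← NNReal.coe_lt_coe]; simpa [hp0.le] using hpn) (by
      simp only [Real.coe_toNNReal _ hp0.le, Real.coe_toNNReal _ hq0.le, finrank_euclideanSpace,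
        Fintype.card_fin, NNReal.coe_inv]
      have hnp : 0 < (n : ℝ) - p := by linarith
      have : p⁻¹ - (n : ℝ)⁻¹ = (n * p / (n - p))⁻¹ := by field_simp
      rw [this]
      exact inv_anti₀ hq0 hq) hbdd
  rw [eLpNorm_eq_lintegral_rpow_enorm_toReal (by simpa using hq0) (by simp),
    eLpNorm_eq_lintegral_rpow_enorm_toReal (by simpa using hp0) (by simp)] at hsob
  simp only [ENNReal.coe_toReal, Real.coe_toNNReal _ hp0.le, Real.coe_toNNReal _ hq0.le] at hsob
  have hK : ∫⁻ x in K, ‖g x - c‖ₑ ^ q ≤ ((S : ℝ≥0∞) * C₂ ^ (1 / p)) ^ q * A ^ (q / p) := by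
    calc ∫⁻ x in K, ‖g x - c‖ₑ ^ q = ∫⁻ x in K, ‖h x‖ₑ ^ q :=
          setLIntegral_congr_fun hKm fun x hx => by simp [hh, hηone x hx]
      _ ≤ ∫⁻ x, ‖h x‖ₑ ^ q := setLIntegral_le_lintegral _ _
      _ = ((∫⁻ x, ‖h x‖ₑ ^ q) ^ (1 / q)) ^ q := by
          rw [← ENNReal.rpow_mul, one_div_mul_cancel hq0.ne', ENNReal.rpow_one]
      _ ≤ (S * (C₂ * A) ^ (1 / p)) ^ q := by
          refine ENNReal.rpow_le_rpow (hsob.trans ?_) hq0.le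
          gcongr
      _ = _ := by
          rw [ENNReal.mul_rpow_of_nonneg C₂ A (by positivity), ← mul_assoc,
            ENNReal.mul_rpow_of_nonneg _ _ hq0.le, ← ENNReal.rpow_mul A]
          congr 2
          ring
  calc ∫⁻ y in K, ∫⁻ x in K, ‖g x - g y‖ₑ ^ q
      ≤ ∫⁻ y in K, ∫⁻ x in K, 2 ^ (q - 1) * (‖g x - c‖ₑ ^ q + ‖g y - c‖ₑ ^ q) := by
        gcongr with y x
        exact enorm_sub_rpow_le_two_rpow_mul (by linarith) _ _ _
    _ = 2 ^ (q - 1) * (2 * volume K) * ∫⁻ x in K, ‖g x - c‖ₑ ^ q := by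
        have : ∀ y, ∫⁻ x in K, 2 ^ (q - 1) * (‖g x - c‖ₑ ^ q + ‖g y - c‖ₑ ^ q) =
            2 ^ (q - 1) * ((∫⁻ x in K, ‖g x - c‖ₑ ^ q) + ‖g y - c‖ₑ ^ q * volume K) := by
          intro y
          rw [lintegral_const_mul' _ _ (by finiteness), lintegral_add_right _ measurable_const,
            setLIntegral_const]
        simp_rw [this]
        rw [lintegral_const_mul' _ _ (by finiteness), lintegral_add_left measurable_const,
          setLIntegral_const, lintegral_mul_const' _ _ hvolt]
        ring
    _ ≤ 2 ^ (q - 1) * (2 * volume K) * (((S : ℝ≥0∞) * C₂ ^ (1 / p)) ^ q * A ^ (q / p)) := by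
        gcongr
    _ = C₃ * A ^ (q / p) := by rw [hC₃]; ring

end

section

open Filter
open scoped Topology Convolution

section Mollify

variable {E : Type*} [NormedAddCommGroup E] [InnerProductSpace ℝ E] [FiniteDimensional ℝ E]
  [MeasurableSpace E] [BorelSpace E] (φ : ContDiffBump (0 : E)) {f : E → ℝ} {L : ℝ≥0}

/-- The convolution of `f` with a normalized bump function. -/
def mollify (φ : ContDiffBump (0 : E)) (f : E → ℝ) : E → ℝ :=
  fun x => ∫ y, φ.normed volume y * f (x - y)

theorem mollify_eq_convolution (f : E → ℝ) :
    mollify φ f = (φ.normed volume ⋆[ContinuousLinearMap.lsmul ℝ ℝ, volume] f) := rfl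

theorem contDiff_mollify (hf : Continuous f) : ContDiff ℝ 1 (mollify φ f) := by
  rw [mollify_eq_convolution]
  exact φ.hasCompactSupport_normed.contDiff_convolution_left _ (φ.contDiff_normed (n := 1))
    hf.locallyIntegrable

theorem hasFDerivAt_mollify (hf : LipschitzWith L f) (x : E) :
    HasFDerivAt (mollify φ f) (∫ y, φ.normed volume y • fderiv ℝ f (x - y)) x := by
  have hρ := φ.continuous_normed (μ := (volume : Measure E))
  have hfc := hf.continuous
  refine (hasFDerivAt_integral_of_dominated_loc_of_lip (μ := (volume : Measure E))
    (F := fun x y => φ.normed volume y * f (x - y)) (x₀ := x)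
    (F' := fun y => φ.normed volume y • fderiv ℝ f (x - y))
    (bound := fun y => φ.normed volume y * L) univ_mem ?_ ?_ ?_ ?_ ?_ ?_).2
  · refine Eventually.of_forall fun z => Continuous.aestronglyMeasurable (by fun_prop)
  · refine Continuous.integrable_of_hasCompactSupport (by fun_prop) ?_
    exact φ.hasCompactSupport_normed.mul_right
  · refine AEStronglyMeasurable.smul hρ.aestronglyMeasurable ?_
    exact ((measurable_fderiv ℝ f).comp (measurable_const.sub measurable_id)).aestronglyMeasurable
  · refine Eventually.of_forall fun y => LipschitzOnWith.of_dist_le_mul fun a _ b _ => ?_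
    rw [Real.dist_eq, ← mul_sub, abs_mul, Real.coe_nnabs, abs_mul, mul_assoc]
    gcongr
    have := hf.dist_le_mul (a - y) (b - y)
    rw [dist_sub_right, Real.dist_eq] at this
    simpa using this
  · exact φ.integrable_normed.mul_const _
  · have hae : ∀ᵐ y : E, DifferentiableAt ℝ f (x - y) :=
      (Measure.measurePreserving_sub_left (volume : Measure E) x).quasiMeasurePreserving.ae
        hf.ae_differentiableAt
    filter_upwards [hae] with y hy
    have h1 : HasFDerivAt (fun z => f (z - y)) (fderiv ℝ f (x - y)) x := by
      have := hy.hasFDerivAt.comp x ((hasFDerivAt_id x).sub_const y)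
      simpa [Function.comp_def] using this
    exact h1.const_mul _

theorem lintegral_enorm_fderiv_mollify_rpow_le (hf : LipschitzWith L f) {p : ℝ} (hp : 1 ≤ p)
    {K K' : Set E} (hK' : MeasurableSet K')
    (hsub : ∀ x ∈ K, ∀ y, ‖y‖ < φ.rOut → x - y ∈ K') :
    ∫⁻ x in K, ‖fderiv ℝ (mollify φ f) x‖ₑ ^ p ≤ ∫⁻ x in K', ‖fderiv ℝ f x‖ₑ ^ p := by
  set ν : Measure E := volume.withDensity fun y => ENNReal.ofReal (φ.normed volume y) with hν
  have hρ := φ.continuous_normed (μ := (volume : Measure E))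
  have hρm : Measurable fun y => ENNReal.ofReal (φ.normed volume y) :=
    hρ.measurable.ennreal_ofReal
  have hprob : IsProbabilityMeasure ν := by
    refine ⟨?_⟩
    rw [hν, withDensity_apply _ MeasurableSet.univ, Measure.restrict_univ,
      ← ofReal_integral_eq_lintegral_ofReal φ.integrable_normed
        (Eventually.of_forall fun y => φ.nonneg_normed y), φ.integral_normed, ENNReal.ofReal_one]
  have hG : Measurable fun z => ‖fderiv ℝ f z‖ₑ ^ p :=
    (measurable_fderiv ℝ f).enorm.pow_const _
  have hpt : ∀ x, ‖fderiv ℝ (mollify φ f) x‖ₑ ^ p ≤ ∫⁻ y, ‖fderiv ℝ f (x - y)‖ₑ ^ p ∂ν := by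
    intro x
    have hm : Measurable fun y => ‖fderiv ℝ f (x - y)‖ₑ :=
      ((measurable_fderiv ℝ f).comp (measurable_const.sub measurable_id)).enorm
    refine le_trans ?_ (rpow_lintegral_le_lintegral_rpow ν hp hm.aemeasurable)
    gcongr
    rw [(hasFDerivAt_mollify φ hf x).fderiv, hν, lintegral_withDensity_eq_lintegral_mul _ hρm hm]
    refine (enorm_integral_le_lintegral_enorm _).trans (lintegral_mono fun y => ?_)
    rw [enorm_smul, Real.enorm_of_nonneg (φ.nonneg_normed y)]
    rfl
  have hball : ∀ᵐ y ∂ν, ‖y‖ < φ.rOut := by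
    rw [hν, ae_withDensity_iff hρm]
    refine Eventually.of_forall fun y hy => ?_
    have : y ∈ Function.support (φ.normed (volume : Measure E)) := by
      intro h0
      exact hy (by simp [h0])
    rw [φ.support_normed_eq] at this
    simpa using this
  calc ∫⁻ x in K, ‖fderiv ℝ (mollify φ f) x‖ₑ ^ p
      ≤ ∫⁻ x in K, ∫⁻ y, ‖fderiv ℝ f (x - y)‖ₑ ^ p ∂ν := lintegral_mono hpt
    _ = ∫⁻ y, ∫⁻ x in K, ‖fderiv ℝ f (x - y)‖ₑ ^ p ∂volume ∂ν := by
        refine lintegral_lintegral_swap (Measurable.aemeasurable ?_)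
        exact hG.comp (measurable_fst.sub measurable_snd)
    _ ≤ ∫⁻ _y, ∫⁻ x in K', ‖fderiv ℝ f x‖ₑ ^ p ∂volume ∂ν := by
        refine lintegral_mono_ae ?_
        filter_upwards [hball] with y hy
        calc ∫⁻ x in K, ‖fderiv ℝ f (x - y)‖ₑ ^ p
            ≤ ∫⁻ x in K, K'.indicator (fun z => ‖fderiv ℝ f z‖ₑ ^ p) (x - y) := by
              refine setLIntegral_mono ((hG.indicator hK').comp (measurable_id.sub_const y))
                fun x hx => ?_
              rw [indicator_of_mem (hsub x hx y hy)]
          _ ≤ ∫⁻ x, K'.indicator (fun z => ‖fderiv ℝ f z‖ₑ ^ p) (x - y) :=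
              setLIntegral_le_lintegral _ _
          _ = _ := by
              rw [lintegral_sub_right_eq_self, lintegral_indicator hK']
    _ = _ := by simp

end Mollify

theorem lintegral_lintegral_enorm_sub_rpow_le_of_tendsto {α : Type*} [MeasurableSpace α]
    (μ : Measure α) [SFinite μ] {g : ℕ → α → ℝ} {f : α → ℝ} (hg : ∀ k, Measurable (g k))
    (hlim : ∀ x, Tendsto (fun k => g k x) atTop (𝓝 (f x))) {q : ℝ} {B : ℝ≥0∞}
    (hB : ∀ k, ∫⁻ y, ∫⁻ x, ‖g k x - g k y‖ₑ ^ q ∂μ ∂μ ≤ B) :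
    ∫⁻ y, ∫⁻ x, ‖f x - f y‖ₑ ^ q ∂μ ∂μ ≤ B := by
  have hpt : ∀ x y, ‖f x - f y‖ₑ ^ q = liminf (fun k => ‖g k x - g k y‖ₑ ^ q) atTop := by
    intro x y
    refine (Tendsto.liminf_eq ?_).symm
    exact ((ENNReal.continuous_rpow_const.comp continuous_enorm).tendsto _).comp
      ((hlim x).sub (hlim y))
  calc ∫⁻ y, ∫⁻ x, ‖f x - f y‖ₑ ^ q ∂μ ∂μ
      ≤ ∫⁻ y, liminf (fun k => ∫⁻ x, ‖g k x - g k y‖ₑ ^ q ∂μ) atTop ∂μ := by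
        refine lintegral_mono fun y => ?_
        simp_rw [hpt]
        refine lintegral_liminf_le fun k => ?_
        have := hg k
        fun_prop
    _ ≤ liminf (fun k => ∫⁻ y, ∫⁻ x, ‖g k x - g k y‖ₑ ^ q ∂μ ∂μ) atTop := by
        refine lintegral_liminf_le fun k => ?_
        have := hg k
        exact Measurable.lintegral_prod_right' (f := fun z : α × α => ‖g k z.2 - g k z.1‖ₑ ^ q)
          (by fun_prop)
    _ ≤ B := by
        refine (liminf_le_liminf (Eventually.of_forall hB)).trans ?_
        simp

/-- Sobolev–Poincaré inequality on the unit cube for Lipschitz functions. -/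
theorem exists_sobolev_poincare_unit_of_lipschitz (n : ℕ) {p q l : ℝ} (hp : 1 < p) (hpq : p ≤ q)
    (hpn : p < n) (hq : q ≤ n * p / (n - p)) (hl : 1 < l) :
    ∃ C : ℝ≥0, ∀ (f : Rn n → ℝ) (L : ℝ≥0), LipschitzWith L f →
      ∫⁻ y in CubeC 0 1, ∫⁻ x in CubeC 0 1, ‖f x - f y‖ₑ ^ q ≤
        C * (∫⁻ x in CubeC (0 : Rn n) l, ‖fderiv ℝ f x‖ₑ ^ p) ^ (q / p) := by
  obtain ⟨C, hC⟩ := exists_sobolev_poincare_unit_of_contDiff n hp hpq hpn hq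
    (show 1 < (1 + l) / 2 by linarith)
  refine ⟨C, fun f L hf => ?_⟩
  have hδ : 0 < (l - 1) / 2 := by linarith
  let φ : ℕ → ContDiffBump (0 : Rn n) := fun k =>
    ⟨(l - 1) / 2 / (k + 2), (l - 1) / 2 / (k + 1), by positivity, by gcongr; norm_num⟩
  have hφ : Tendsto (fun k => (φ k).rOut) atTop (𝓝 0) := by
    have := (tendsto_one_div_add_atTop_nhds_zero_nat (𝕜 := ℝ)).const_mul ((l - 1) / 2)
    simpa [φ, div_eq_mul_inv] using this
  refine lintegral_lintegral_enorm_sub_rpow_le_of_tendsto _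
    (g := fun k => mollify (φ k) f)
    (fun k => (contDiff_mollify (φ k) hf.continuous).continuous.measurable)
    (fun x => ContDiffBump.convolution_tendsto_right_of_continuous hφ hf.continuous x) fun k => ?_
  refine (hC _ (contDiff_mollify (φ k) hf.continuous)).trans ?_
  refine mul_le_mul_right (ENNReal.rpow_le_rpow ?_ (div_nonneg (by linarith) (by linarith))) _
  refine lintegral_enorm_fderiv_mollify_rpow_le (φ k) hf hp.le (measurableSet_cubeC _ _)
    fun x hx y hy => ?_
  have hr : (φ k).rOut ≤ (l - 1) / 2 := div_le_self hδ.le (by simp)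
  have h1 : x - y ∈ CubeC x ((l - 1) / 2) := by
    refine mem_cubeC_of_dist_lt ?_
    rw [dist_eq_norm]
    simpa using hy.trans_le hr
  have := cubeC_trans hx h1
  convert this using 2
  ring

end

section

open Filter
open scoped Topology

theorem setLIntegral_cubeC_mul {n : ℕ} (x : Rn n) {r s : ℝ} (hs : 0 < s) (F : Rn n → ℝ≥0∞) :
    ∫⁻ z in CubeC x (s * r), F z =
      ENNReal.ofReal s ^ n * ∫⁻ y in CubeC 0 r, F (s • y + x) := by
  rw [← lintegral_indicator (measurableSet_cubeC _ _), ← lintegral_indicator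
    (measurableSet_cubeC _ _)]
  have h1 : ∀ y, (CubeC 0 r).indicator (fun y => F (s • y + x)) y =
      (CubeC x (s * r)).indicator F (s • y + x) := by
    intro y
    by_cases hy : y ∈ CubeC 0 r
    · rw [indicator_of_mem hy, indicator_of_mem ((smul_add_mem_cubeC_iff hs).2 hy)]
    · rw [indicator_of_notMem hy, indicator_of_notMem (mt (smul_add_mem_cubeC_iff hs).1 hy)]
  simp_rw [h1]
  rw [lintegral_comp_smul_add volume _ hs.ne', ← mul_assoc, finrank_euclideanSpace_fin,
    abs_of_pos (by positivity), ← ENNReal.ofReal_pow hs.le, ← ENNReal.ofReal_mul (by positivity),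
    mul_inv_cancel₀ (by positivity), ENNReal.ofReal_one, one_mul]

theorem cubeC_mem_nhds {n : ℕ} {x z : Rn n} {r s : ℝ} (h : r < s) (hz : z ∈ CubeC x r) :
    CubeC x s ∈ 𝓝 z := by
  filter_upwards [Metric.ball_mem_nhds z (sub_pos.2 h)] with y hy
  have := cubeC_trans hz (mem_cubeC_of_dist_lt hy)
  rwa [add_sub_cancel] at this

/-- Sobolev–Poincaré inequality on a cube, with the gradient integrated over a dilated cube. -/
theorem exists_sobolev_poincare_cubeC (n : ℕ) {p q l : ℝ} (hp : 1 < p) (hpq : p ≤ q)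
    (hpn : p < n) (hq : q ≤ n * p / (n - p)) (hl : 1 < l) :
    ∃ C : ℝ≥0, ∀ (x : Rn n) (s : ℝ), 0 < s → ∀ (u : Rn n → ℝ) (L : ℝ≥0),
      LipschitzOnWith L u (CubeC x (s * l)) → ∃ c : ℝ,
      ∫⁻ z in CubeC x s, ‖u z - c‖ₑ ^ q ≤
        C * ENNReal.ofReal s ^ (n - q / p * (n - p)) *
          (∫⁻ z in CubeC x (s * l), ‖fderiv ℝ u z‖ₑ ^ p) ^ (q / p) := by
  have hl' : 1 < (1 + l) / 2 := by linarith
  have hl'l : (1 + l) / 2 < l := by linarith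
  have hqp : 0 ≤ q / p := div_nonneg (by linarith) (by linarith)
  obtain ⟨C, hC⟩ := exists_sobolev_poincare_unit_of_lipschitz n hp hpq hpn hq hl'
  refine ⟨C, fun x s hs u L hu => ?_⟩
  obtain ⟨v, hv, huv⟩ := hu.extend_real
  set S := ENNReal.ofReal s with hS
  have hS0 : S ≠ 0 := by simpa [hS] using hs
  have hSt : S ≠ ⊤ := ENNReal.ofReal_ne_top
  have hf : LipschitzWith (L * ‖s‖₊) fun y : Rn n => v (s • y + x) := by
    refine LipschitzWith.of_dist_le_mul fun a b => ?_
    refine (hv.dist_le_mul _ _).trans ?_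
    rw [dist_add_right, dist_smul₀]
    simp [mul_assoc]
  have hmain := hC _ _ hf
  have hvol : volume (CubeC (0 : Rn n) 1) = 2 ^ n := by rw [volume_cubeC]; simp
  obtain ⟨y, hy, hyle⟩ := exists_le_setLAverage (μ := volume) (s := CubeC (0 : Rn n) 1)
    (f := fun y => ∫⁻ x' in CubeC 0 1, ‖v (s • x' + x) - v (s • y + x)‖ₑ ^ q)
    (by rw [hvol]; positivity) (by rw [hvol]; finiteness)
    (by
      have := hv.continuous.measurable
      exact (Measurable.lintegral_prod_right'
        (f := fun z : Rn n × Rn n => ‖v (s • z.2 + x) - v (s • z.1 + x)‖ₑ ^ q)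
          (by fun_prop)).aemeasurable)
  rw [setLAverage_eq, hvol] at hyle
  refine ⟨v (s • y + x), ?_⟩
  have hgrad : ∫⁻ z in CubeC (0 : Rn n) ((1 + l) / 2), ‖fderiv ℝ (fun y => v (s • y + x)) z‖ₑ ^ p
      ≤ S ^ p * (S ^ n)⁻¹ * ∫⁻ z in CubeC x (s * l), ‖fderiv ℝ u z‖ₑ ^ p := by
    have h1 : ∀ z, ‖fderiv ℝ (fun y => v (s • y + x)) z‖ₑ ^ p =
        S ^ p * ‖fderiv ℝ v (s • z + x)‖ₑ ^ p := by
      intro z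
      rw [fderiv_comp_smul (f := fun y => v (y + x)) s, fderiv_comp_add_right, enorm_smul,
        ENNReal.mul_rpow_of_nonneg _ _ (by linarith), Real.enorm_of_nonneg hs.le]
    simp_rw [h1]
    rw [lintegral_const_mul' _ _ (by finiteness), mul_assoc]
    refine mul_le_mul_right ?_ _
    have h2 := setLIntegral_cubeC_mul x (r := (1 + l) / 2) hs fun z => ‖fderiv ℝ v z‖ₑ ^ p
    have h3 : ∫⁻ z in CubeC x (s * ((1 + l) / 2)), ‖fderiv ℝ v z‖ₑ ^ p ≤
        ∫⁻ z in CubeC x (s * l), ‖fderiv ℝ u z‖ₑ ^ p := by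
      have hlt : s * ((1 + l) / 2) < s * l := by gcongr
      calc _ = ∫⁻ z in CubeC x (s * ((1 + l) / 2)), ‖fderiv ℝ u z‖ₑ ^ p := by
            refine setLIntegral_congr_fun (measurableSet_cubeC _ _) fun z hz => ?_
            have : u =ᶠ[𝓝 z] v := by
              filter_upwards [cubeC_mem_nhds hlt hz] with a ha using huv ha
            simp only [this.fderiv_eq]
        _ ≤ _ := lintegral_mono_set (cubeC_subset_cubeC x hlt.le)
    rw [h2] at h3
    calc _ = (S ^ n)⁻¹ * (S ^ n * ∫⁻ z in CubeC 0 ((1 + l) / 2), ‖fderiv ℝ v (s • z + x)‖ₑ ^ p) := by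
          rw [← mul_assoc, ENNReal.inv_mul_cancel (by positivity) (by finiteness), one_mul]
      _ ≤ _ := mul_le_mul_right h3 _
  have hl1 : s * 1 < s * l := by gcongr
  calc ∫⁻ z in CubeC x s, ‖u z - v (s • y + x)‖ₑ ^ q
      = ∫⁻ z in CubeC x (s * 1), ‖v z - v (s • y + x)‖ₑ ^ q := by
        rw [mul_one]
        refine setLIntegral_congr_fun (measurableSet_cubeC _ _) fun z hz => ?_
        rw [mul_one] at hl1
        simp only [huv (cubeC_subset_cubeC x hl1.le hz)]
    _ = S ^ n * ∫⁻ z in CubeC 0 1, ‖v (s • z + x) - v (s • y + x)‖ₑ ^ q :=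
        setLIntegral_cubeC_mul x hs _
    _ ≤ S ^ n * (C * (S ^ p * (S ^ n)⁻¹ *
          ∫⁻ z in CubeC x (s * l), ‖fderiv ℝ u z‖ₑ ^ p) ^ (q / p)) := by
        refine mul_le_mul_right (hyle.trans ?_) _
        refine (ENNReal.div_le_of_le_mul ?_).trans (hmain.trans
          (mul_le_mul_right (ENNReal.rpow_le_rpow hgrad hqp) _))
        exact le_mul_of_one_le_right (by positivity) (one_le_pow₀ (by norm_num))
    _ = _ := by
        rw [ENNReal.mul_rpow_of_nonneg _ _ hqp, ← ENNReal.rpow_natCast, ← ENNReal.rpow_neg,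
          ← ENNReal.rpow_add _ _ hS0 hSt, ← ENNReal.rpow_mul]
        have : (n : ℝ) - q / p * (n - p) = n + (p + -n) * (q / p) := by ring
        rw [this, ENNReal.rpow_add _ _ hS0 hSt]
        ring

end

theorem lintegral_Ioi_ite_rpow {s x : ℝ} (hs : 0 < s) (hx : 0 ≤ x) :
    ∫⁻ t in Ioi (0 : ℝ), (if t < x then ENNReal.ofReal (s * t ^ (s - 1)) else 0) =
      ENNReal.ofReal (x ^ s) := by
  have hint : IntervalIntegrable (fun t : ℝ => s * t ^ (s - 1)) volume 0 x :=
    (intervalIntegral.intervalIntegrable_rpow' (by linarith)).const_mul s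
  have h1 : ∀ t : ℝ, (if t < x then ENNReal.ofReal (s * t ^ (s - 1)) else 0) =
      (Iio x).indicator (fun t => ENNReal.ofReal (s * t ^ (s - 1))) t := fun t => by
    simp [indicator_apply]
  simp_rw [h1]
  rw [lintegral_indicator measurableSet_Iio, Measure.restrict_restrict measurableSet_Iio,
    inter_comm, Ioi_inter_Iio, restrict_Ioo_eq_restrict_Ioc, ← ofReal_integral_eq_lintegral_ofReal]
  · rw [← intervalIntegral.integral_of_le hx, intervalIntegral.integral_const_mul,
      integral_rpow (Or.inl (by linarith)), sub_add_cancel, Real.zero_rpow hs.ne', sub_zero,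
      mul_div_cancel₀ _ hs.ne']
  · exact (intervalIntegrable_iff_integrableOn_Ioc_of_le hx).1 hint
  · filter_upwards [ae_restrict_mem measurableSet_Ioc] with t ht
    have := ht.1
    positivity

/-- The averages of `g` over shadows satisfy a weak type `(1, 1)` estimate. -/
theorem sum_filter_lt_le_of_shadow {ι : Type*} [DecidableEq ι] (F T : Finset ι)
    (C : ι → Finset ι) {m g : ι → ℝ} (hm : ∀ R ∈ T, 0 < m R) (hmF : ∀ Q ∈ F, 0 ≤ m Q)
    (hg : ∀ Q ∈ F, 0 ≤ g Q) {K t : ℝ} (hK : 0 ≤ K) (ht : 0 < t)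
    (hcov : ∀ A ⊆ T, ∃ B ⊆ A, (∀ Q ∈ F, ∀ R ∈ B, ∀ R' ∈ B, R ∈ C Q → R' ∈ C Q → R = R') ∧
      ∑ R ∈ A, m R ≤ K * ∑ R ∈ B, m R) :
    ∑ R ∈ T with t < (∑ Q ∈ F with R ∈ C Q, g Q * m Q) / m R, m R ≤
      K / t * ∑ Q ∈ F, g Q * m Q := by
  obtain ⟨B, hBA, hB, hle⟩ := hcov _ (Finset.filter_subset
    (fun R => t < (∑ Q ∈ F with R ∈ C Q, g Q * m Q) / m R) T)
  refine hle.trans ?_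
  rw [div_mul_eq_mul_div, mul_div_assoc]
  refine mul_le_mul_of_nonneg_left ?_ hK
  rw [le_div_iff₀ ht, Finset.sum_mul]
  have hBm : ∀ R ∈ B, m R * t ≤ ∑ Q ∈ F with R ∈ C Q, g Q * m Q := by
    intro R hR
    have := Finset.mem_filter.1 (hBA hR)
    rw [lt_div_iff₀ (hm R this.1)] at this
    linarith [this.2]
  refine (Finset.sum_le_sum hBm).trans ?_
  rw [← Finset.sum_biUnion]
  · refine Finset.sum_le_sum_of_subset_of_nonneg ?_ fun Q hQ _ => mul_nonneg (hg Q hQ) (hmF Q hQ)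
    exact Finset.biUnion_subset.2 fun R _ => Finset.filter_subset _ _
  · intro R hR S hS hne
    refine Finset.disjoint_left.2 fun Q hQR hQS => hne ?_
    rw [Finset.mem_filter] at hQR hQS
    exact hB Q hQR.1 R hR S hS hQR.2 hQS.2

/-- The averages of `g` over shadows satisfy a strong type estimate. -/
theorem sum_mul_shadow_average_rpow_le {ι : Type*} [DecidableEq ι] (F T : Finset ι)
    (C : ι → Finset ι) {m g : ι → ℝ} (hm : ∀ R ∈ T, 0 < m R) (hmF : ∀ Q ∈ F, 0 ≤ m Q)
    (hg : ∀ Q ∈ F, 0 ≤ g Q) {K L s : ℝ} (hK : 0 ≤ K) (hL : 0 < L) (hs : 1 < s)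
    (hcov : ∀ A ⊆ T, ∃ B ⊆ A, (∀ Q ∈ F, ∀ R ∈ B, ∀ R' ∈ B, R ∈ C Q → R' ∈ C Q → R = R') ∧
      ∑ R ∈ A, m R ≤ K * ∑ R ∈ B, m R)
    (hsh : ∀ R ∈ T, ∑ Q ∈ F with R ∈ C Q, m Q ≤ L * m R) :
    ∑ R ∈ T, m R * ((∑ Q ∈ F with R ∈ C Q, g Q * m Q) / m R) ^ s ≤
      2 * K * (s / (s - 1)) * (2 * L) ^ (s - 1) * ∑ Q ∈ F, m Q * g Q ^ s := by
  have hs1 : 0 < s - 1 := by linarith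
  set f : ι → ℝ := fun R => (∑ Q ∈ F with R ∈ C Q, g Q * m Q) / m R with hf
  have hf0 : ∀ R ∈ T, 0 ≤ f R := fun R hR => div_nonneg
    (Finset.sum_nonneg fun Q hQ => mul_nonneg (hg Q (Finset.mem_filter.1 hQ).1)
      (hmF Q (Finset.mem_filter.1 hQ).1)) (hm R hR).le
  have hweak : ∀ t : ℝ, 0 < t → ∑ R ∈ T with t < f R, m R ≤
      2 * K / t * ∑ Q ∈ F with t < 2 * L * g Q, g Q * m Q := by
    intro t ht
    have h1 := sum_filter_lt_le_of_shadow F T C (g := fun Q => if t < 2 * L * g Q then g Q else 0)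
      hm hmF (fun Q hQ => by split_ifs; exacts [hg Q hQ, le_rfl]) hK (half_pos ht) hcov
    refine le_trans (Finset.sum_le_sum_of_subset_of_nonneg ?_ fun R hR _ =>
      (hm R (Finset.mem_filter.1 hR).1).le) (h1.trans (le_of_eq ?_))
    · intro R hR
      rw [Finset.mem_filter] at hR ⊢
      refine ⟨hR.1, ?_⟩
      have hmR := hm R hR.1
      have h2 := hR.2
      simp only [hf] at h2
      rw [lt_div_iff₀ hmR] at h2 ⊢
      have h3 : ∑ Q ∈ F with R ∈ C Q, g Q * m Q ≤
          ∑ Q ∈ F with R ∈ C Q, (if t < 2 * L * g Q then g Q else 0) * m Q +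
            t / (2 * L) * ∑ Q ∈ F with R ∈ C Q, m Q := by
        rw [Finset.mul_sum, ← Finset.sum_add_distrib]
        refine Finset.sum_le_sum fun Q hQ => ?_
        have hmQ := hmF Q (Finset.mem_filter.1 hQ).1
        rw [← add_mul]
        refine mul_le_mul_of_nonneg_right ?_ hmQ
        split_ifs with h
        · have : 0 ≤ t / (2 * L) := by positivity
          linarith
        · rw [zero_add, le_div_iff₀ (by positivity)]
          linarith
      have h4 : t / (2 * L) * ∑ Q ∈ F with R ∈ C Q, m Q ≤ t / 2 * m R := by
        calc _ ≤ t / (2 * L) * (L * m R) := by gcongr; exact hsh R hR.1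
          _ = _ := by field_simp
      linarith
    · rw [Finset.sum_filter]
      congr 1
      · field_simp
      · refine Finset.sum_congr rfl fun Q _ => ?_
        split_ifs <;> simp
  rw [← ENNReal.ofReal_le_ofReal_iff (mul_nonneg (by positivity)
    (Finset.sum_nonneg fun Q hQ => mul_nonneg (hmF Q hQ) (Real.rpow_nonneg (hg Q hQ) _)))]
  have hmeas : ∀ s x : ℝ, Measurable fun t : ℝ =>
      if t < x then ENNReal.ofReal (s * t ^ (s - 1)) else 0 := fun s x =>
    Measurable.ite measurableSet_Iio (by fun_prop) measurable_const
  calc ENNReal.ofReal (∑ R ∈ T, m R * f R ^ s)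
      = ∑ R ∈ T, ENNReal.ofReal (m R) *
          ∫⁻ t in Ioi (0 : ℝ), (if t < f R then ENNReal.ofReal (s * t ^ (s - 1)) else 0) := by
        rw [ENNReal.ofReal_sum_of_nonneg fun R hR =>
          mul_nonneg (hm R hR).le (Real.rpow_nonneg (hf0 R hR) _)]
        refine Finset.sum_congr rfl fun R hR => ?_
        rw [lintegral_Ioi_ite_rpow (by linarith) (hf0 R hR), ENNReal.ofReal_mul (hm R hR).le]
    _ = ∫⁻ t in Ioi (0 : ℝ), ∑ R ∈ T, ENNReal.ofReal (m R) *
          (if t < f R then ENNReal.ofReal (s * t ^ (s - 1)) else 0) := by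
        rw [lintegral_finsetSum _ fun R _ => (hmeas s (f R)).const_mul _]
        exact Finset.sum_congr rfl fun R _ => (lintegral_const_mul _ (hmeas s (f R))).symm
    _ ≤ ∫⁻ t in Ioi (0 : ℝ), ∑ Q ∈ F, ENNReal.ofReal (2 * K * (s / (s - 1)) * (g Q * m Q)) *
          (if t < 2 * L * g Q then ENNReal.ofReal ((s - 1) * t ^ (s - 1 - 1)) else 0) := by
        refine setLIntegral_mono (Finset.measurable_sum _ fun Q _ =>
          (hmeas (s - 1) _).const_mul _) fun t (ht : 0 < t) => ?_
        have e1 : ∑ R ∈ T, ENNReal.ofReal (m R) *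
            (if t < f R then ENNReal.ofReal (s * t ^ (s - 1)) else 0) =
            ENNReal.ofReal (s * t ^ (s - 1) * ∑ R ∈ T with t < f R, m R) := by
          rw [Finset.mul_sum, ENNReal.ofReal_sum_of_nonneg, Finset.sum_filter]
          · refine Finset.sum_congr rfl fun R hR => ?_
            split_ifs
            · rw [mul_comm (s * _), ENNReal.ofReal_mul (hm R hR).le]
            · simp
          · intro R hR
            have := hm R (Finset.mem_filter.1 hR).1
            positivity
        have e2 : ∑ Q ∈ F, ENNReal.ofReal (2 * K * (s / (s - 1)) * (g Q * m Q)) *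
            (if t < 2 * L * g Q then ENNReal.ofReal ((s - 1) * t ^ (s - 1 - 1)) else 0) =
            ENNReal.ofReal (s * t ^ (s - 1) *
              (2 * K / t * ∑ Q ∈ F with t < 2 * L * g Q, g Q * m Q)) := by
          rw [← mul_assoc, Finset.mul_sum, ENNReal.ofReal_sum_of_nonneg, Finset.sum_filter]
          · refine Finset.sum_congr rfl fun Q hQ => ?_
            split_ifs
            · have h0 := mul_nonneg (hg Q hQ) (hmF Q hQ)
              rw [← ENNReal.ofReal_mul (by positivity), Real.rpow_sub_one ht.ne' (s - 1)]
              congr 1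
              field_simp
            · simp
          · intro Q hQ
            have hQ := (Finset.mem_filter.1 hQ).1
            have h0 := mul_nonneg (hg Q hQ) (hmF Q hQ)
            positivity
        rw [e1, e2]
        exact ENNReal.ofReal_le_ofReal (mul_le_mul_of_nonneg_left (hweak t ht) (by positivity))
    _ = ∑ Q ∈ F, ENNReal.ofReal (2 * K * (s / (s - 1)) * (g Q * m Q)) *
          ENNReal.ofReal ((2 * L * g Q) ^ (s - 1)) := by
        rw [lintegral_finsetSum _ fun Q _ => (hmeas (s - 1) _).const_mul _]
        refine Finset.sum_congr rfl fun Q hQ => ?_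
        have := hg Q hQ
        rw [lintegral_const_mul _ (hmeas (s - 1) _), lintegral_Ioi_ite_rpow hs1 (by positivity)]
    _ = _ := by
        rw [Finset.mul_sum, ENNReal.ofReal_sum_of_nonneg]
        · refine Finset.sum_congr rfl fun Q hQ => ?_
          have h1 := hg Q hQ
          have h2 := hmF Q hQ
          rw [← ENNReal.ofReal_mul (by positivity), Real.mul_rpow (by positivity) h1]
          congr 1
          rcases h1.eq_or_lt with h | h
          · rw [← h, Real.zero_rpow (by linarith : s ≠ 0)]
            simp
          · have : g Q ^ s = g Q * g Q ^ (s - 1) := by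
              rw [Real.rpow_sub_one h.ne']
              field_simp
            rw [this]
            ring
        · intro Q hQ
          have h1 := hg Q hQ
          have h2 := hmF Q hQ
          positivity

/-- Discrete form of Boman's lemma: sums along chains are controlled in a weighted `ℓ^q`. -/
theorem sum_mul_chain_sum_rpow_le {ι : Type*} [DecidableEq ι] (F T : Finset ι)
    (C : ι → Finset ι) (hC : ∀ Q ∈ F, C Q ⊆ T) {m a : ι → ℝ} (hm : ∀ R ∈ T, 0 < m R)
    (hmF : ∀ Q ∈ F, 0 ≤ m Q) (ha : ∀ R ∈ T, 0 ≤ a R) {K L q : ℝ} (hK : 0 < K) (hL : 0 < L)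
    (hq : 1 < q)
    (hcov : ∀ A ⊆ T, ∃ B ⊆ A, (∀ Q ∈ F, ∀ R ∈ B, ∀ R' ∈ B, R ∈ C Q → R' ∈ C Q → R = R') ∧
      ∑ R ∈ A, m R ≤ K * ∑ R ∈ B, m R)
    (hsh : ∀ R ∈ T, ∑ Q ∈ F with R ∈ C Q, m Q ≤ L * m R) :
    ∑ Q ∈ F, m Q * (∑ R ∈ C Q, a R) ^ q ≤
      (2 * K * q * (2 * L) ^ (1 / (q - 1))) ^ (q - 1) * ∑ R ∈ T, m R * a R ^ q := by
  have hq1 : 0 < q - 1 := by linarith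
  set s : ℝ := q / (q - 1) with hs
  have hconj : q.HolderConjugate s := Real.HolderConjugate.conjExponent hq
  have hs1 : 1 < s := hconj.symm.lt
  have hs1' : s - 1 = 1 / (q - 1) := by rw [hs]; field_simp; ring
  have hs2 : s / (s - 1) = q := by rw [hs1', hs]; field_simp
  set M : ℝ := 2 * K * q * (2 * L) ^ (1 / (q - 1)) with hM
  have hM0 : 0 < M := by positivity
  set S : ι → ℝ := fun Q => ∑ R ∈ C Q, a R with hS
  have hS0 : ∀ Q ∈ F, 0 ≤ S Q := fun Q hQ => Finset.sum_nonneg fun R hR => ha R (hC Q hQ hR)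
  set f : ι → ℝ := fun R => (∑ Q ∈ F with R ∈ C Q, S Q ^ (q - 1) * m Q) / m R with hf
  have hf0 : ∀ R ∈ T, 0 ≤ f R := fun R hR => div_nonneg
    (Finset.sum_nonneg fun Q hQ => mul_nonneg (Real.rpow_nonneg (hS0 Q (Finset.mem_filter.1 hQ).1) _)
      (hmF Q (Finset.mem_filter.1 hQ).1)) (hm R hR).le
  have hstrong : ∑ R ∈ T, m R * f R ^ s ≤ M * ∑ Q ∈ F, m Q * S Q ^ q := by
    have := sum_mul_shadow_average_rpow_le F T C (g := fun Q => S Q ^ (q - 1)) hm hmF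
      (fun Q hQ => Real.rpow_nonneg (hS0 Q hQ) _) hK.le hL hs1 hcov hsh
    rw [hs2, hs1'] at this
    refine this.trans (le_of_eq ?_)
    congr 1
    refine Finset.sum_congr rfl fun Q hQ => ?_
    rw [← Real.rpow_mul (hS0 Q hQ), hs, mul_div_cancel₀ _ hq1.ne']
  have hdual : ∑ Q ∈ F, m Q * S Q ^ q = ∑ R ∈ T, m R * (a R * f R) := by
    have h1 : ∀ Q ∈ F, m Q * S Q ^ q =
        ∑ R ∈ T, if R ∈ C Q then a R * (S Q ^ (q - 1) * m Q) else 0 := by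
      intro Q hQ
      rw [← Finset.sum_filter, Finset.filter_mem_eq_inter, Finset.inter_eq_right.2 (hC Q hQ),
        ← Finset.sum_mul, ← mul_assoc, mul_comm]
      congr 1
      change S Q ^ q = S Q * _
      rcases (hS0 Q hQ).eq_or_lt with h | h
      · rw [← h, Real.zero_rpow (by linarith : q ≠ 0), zero_mul]
      · rw [Real.rpow_sub_one h.ne']
        field_simp
    rw [Finset.sum_congr rfl h1, Finset.sum_comm]
    refine Finset.sum_congr rfl fun R hR => ?_
    rw [← Finset.sum_filter, ← Finset.mul_sum, hf]
    have := (hm R hR).ne'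
    field_simp
  set X := ∑ Q ∈ F, m Q * S Q ^ q with hX
  set Y := ∑ R ∈ T, m R * a R ^ q with hY
  set c : ℝ := M ^ (1 / s) with hc
  have hc0 : 0 < c := by positivity
  have hcs : c ^ s = M := by
    rw [hc, ← Real.rpow_mul hM0.le, one_div_mul_cancel (by linarith : s ≠ 0), Real.rpow_one]
  have hcq : c ^ q = M ^ (q - 1) := by
    rw [hc, ← Real.rpow_mul hM0.le, hs]
    congr 1
    field_simp
  have hyoung : X ≤ c ^ q / q * Y + 1 / (s * M) * ∑ R ∈ T, m R * f R ^ s := by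
    rw [hdual, hY, Finset.mul_sum, Finset.mul_sum, ← Finset.sum_add_distrib]
    refine Finset.sum_le_sum fun R hR => ?_
    have h1 := Real.young_inequality_of_nonneg (mul_nonneg hc0.le (ha R hR))
      (div_nonneg (hf0 R hR) hc0.le) hconj
    rw [Real.mul_rpow hc0.le (ha R hR), Real.div_rpow (hf0 R hR) hc0.le, hcs] at h1
    calc m R * (a R * f R) = m R * (c * a R * (f R / c)) := by field_simp
      _ ≤ m R * (c ^ q * a R ^ q / q + f R ^ s / M / s) :=
        mul_le_mul_of_nonneg_left h1 (hm R hR).le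
      _ = _ := by field_simp
  have h2 : 1 / (s * M) * ∑ R ∈ T, m R * f R ^ s ≤ 1 / s * X := by
    calc _ ≤ 1 / (s * M) * (M * X) := by gcongr
      _ = _ := by field_simp
  have h3 : 1 / q + 1 / s = 1 := by simpa using hconj.inv_add_inv_eq_one
  have h4 : 1 / q * X ≤ 1 / q * (c ^ q * Y) := by
    have : 1 / q * X = X - 1 / s * X := by linear_combination X * h3
    rw [this]
    calc _ ≤ c ^ q / q * Y := by linarith
      _ = _ := by ring
  rw [← hcq]
  exact le_of_mul_le_mul_left h4 (by positivity)

section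

open scoped Topology

namespace WhitneyDecomp

variable {n : ℕ} {Ω : Set (Rn n)} {Cdim : ℝ} (W : WhitneyDecomp n Ω Cdim)

/-- The side lengths of the slightly dilated Whitney cubes are comparable to the distance of any
of their points from the boundary, and the slightly dilated cubes are contained in `Ω`. -/
def Comparable (δ k Λ : ℝ) : Prop :=
  ∀ Q ∈ W.cubes, ∀ y ∈ CubeC (W.center Q) ((9 / 8 + 3 * δ) * W.radius Q),
    y ∈ Ω ∧ k * W.radius Q ≤ Metric.infDist y (frontier Ω) ∧
      Metric.infDist y (frontier Ω) ≤ Λ * W.radius Q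

theorem center_mem {Q : Set (Rn n)} (hQ : Q ∈ W.cubes) : W.center Q ∈ Q :=
  (W.eq_cube Q hQ).superset (mem_cubeC_self _ (W.radius_pos Q hQ))

theorem measurableSet {Q : Set (Rn n)} (hQ : Q ∈ W.cubes) : MeasurableSet Q :=
  (W.eq_cube Q hQ) ▸ measurableSet_cubeC (W.center Q) (W.radius Q)

theorem volume_eq {Q : Set (Rn n)} (hQ : Q ∈ W.cubes) :
    volume Q = ENNReal.ofReal (2 * W.radius Q) ^ n :=
  (congrArg volume (W.eq_cube Q hQ)).trans (volume_cubeC _ _)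

theorem subset {Q : Set (Rn n)} (hQ : Q ∈ W.cubes) : Q ⊆ Ω :=
  (subset_sUnion_of_mem hQ).trans W.union_eq.subset

theorem setDist_le_dist {A B : Set (Rn n)} {x y : Rn n} (hx : x ∈ A) (hy : y ∈ B) :
    setDist A B ≤ dist x y :=
  csInf_le ⟨0, by rintro d ⟨a, _, b, _, rfl⟩; exact dist_nonneg⟩ ⟨x, hx, y, hy, rfl⟩

theorem setDist_nonneg (A B : Set (Rn n)) : 0 ≤ setDist A B :=
  Real.sInf_nonneg (by rintro d ⟨a, _, b, _, rfl⟩; exact dist_nonneg)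

theorem pos_of_mem {Q : Set (Rn n)} (hQ : Q ∈ W.cubes) : 0 < Cdim := by
  by_contra! h
  have h1 := W.dist_lower Q hQ
  have h2 := W.radius_pos Q hQ
  have h3 := mul_nonpos_of_nonpos_of_nonneg h
    (setDist_nonneg (CubeC (W.center Q) (9 / 8 * W.radius Q)) (frontier Ω))
  linarith

theorem frontier_nonempty {Q : Set (Rn n)} (hQ : Q ∈ W.cubes) : (frontier Ω).Nonempty := by
  by_contra! h
  have h1 := W.dist_lower Q hQ
  have h2 := W.radius_pos Q hQ
  have : setDist (CubeC (W.center Q) (9 / 8 * W.radius Q)) (frontier Ω) = 0 := by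
    simp [setDist, h]
  rw [this] at h1
  linarith

theorem _root_.exists_mem_cubeC_dist_le {x y : Rn n} {a b : ℝ} (ha : 0 < a) (hb : 0 ≤ b)
    (hy : y ∈ CubeC x (a + b)) : ∃ z ∈ CubeC x a, dist y z ≤ n * b := by
  set θ : ℝ := a / (a + b) with hθ
  have hab : 0 < a + b := by positivity
  have hθ0 : 0 < θ := by positivity
  have hθa : θ * (a + b) = a := by rw [hθ]; field_simp
  have hθ1 : θ ≤ 1 := (div_le_one hab).2 (by linarith)
  refine ⟨x + θ • (y - x), fun i => ?_, dist_le_of_abs_sub_le hb fun i => ?_⟩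
  · have h1 := hy i
    simp only [PiLp.add_apply, PiLp.smul_apply, PiLp.sub_apply, smul_eq_mul]
    constructor <;> nlinarith
  · have h1 := hy i
    have h2 : |y i - x i| ≤ a + b := abs_le.2 ⟨by linarith, by linarith⟩
    have h3 : y i - (x + θ • (y - x)) i = (1 - θ) * (y i - x i) := by
      simp only [PiLp.add_apply, PiLp.smul_apply, PiLp.sub_apply, smul_eq_mul]
      ring
    rw [h3, abs_mul, abs_of_nonneg (by linarith)]
    calc (1 - θ) * |y i - x i| ≤ (1 - θ) * (a + b) := by gcongr
      _ = b := by rw [sub_mul, hθa]; ring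

theorem _root_.IsPreconnected.subset_of_disjoint_frontier {X : Type*} [TopologicalSpace X]
    {s t : Set X} (hs : IsPreconnected s) (ht : IsOpen t) (hst : (s ∩ t).Nonempty)
    (h : Disjoint s (frontier t)) : s ⊆ t := by
  refine hs.subset_left_of_subset_union ht isClosed_closure.isOpen_compl
    (disjoint_compl_right.mono_left subset_closure) (fun x hx => ?_) hst
  by_cases hxt : x ∈ closure t
  · left
    by_contra hx'
    exact disjoint_left.1 h hx (by rw [ht.frontier_eq]; exact ⟨hxt, hx'⟩)
  · exact Or.inr hxt

theorem exists_comparable (hn : 0 < n) (hC : 0 < Cdim) :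
    ∃ δ k Λ : ℝ, 0 < δ ∧ δ ≤ 1 / 4 ∧ 0 < k ∧ 0 < Λ ∧
      ∀ Ω : Set (Rn n), IsOpen Ω → ∀ W : WhitneyDecomp n Ω Cdim, W.Comparable δ k Λ := by
  have hn' : (0 : ℝ) < n := by exact_mod_cast hn
  refine ⟨min (1 / 4) (3 / (8 * n * Cdim)), 9 / (8 * Cdim), 4 * n + 9 / 4 * Cdim + 1,
    by positivity, min_le_left _ _, by positivity, by positivity, fun Ω hΩ W Q hQ => ?_⟩
  set δ : ℝ := min (1 / 4) (3 / (8 * n * Cdim)) with hδ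
  have hδ0 : 0 < δ := by positivity
  have hδ1 : δ ≤ 1 / 4 := min_le_left _ _
  have hδ2 : n * (3 * δ) ≤ 9 / (8 * Cdim) := by
    calc n * (3 * δ) ≤ n * (3 * (3 / (8 * n * Cdim))) := by gcongr; exact min_le_right _ _
      _ = _ := by field_simp; norm_num
  have hr := W.radius_pos Q hQ
  set r := W.radius Q
  set x := W.center Q
  have hfr := W.frontier_nonempty hQ
  have hlow : ∀ z ∈ CubeC x (9 / 8 * r), 9 / (4 * Cdim) * r ≤ Metric.infDist z (frontier Ω) := by
    intro z hz
    refine (Metric.le_infDist hfr).2 fun b hb => ?_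
    have h1 := W.dist_lower Q hQ
    have h2 := setDist_le_dist hz hb
    have h3 : 9 / 4 * r ≤ Cdim * dist z b := h1.trans (by gcongr)
    rw [div_mul_eq_mul_div, div_le_iff₀ (by positivity)]
    linarith
  have hlow' : ∀ y ∈ CubeC x ((9 / 8 + 3 * δ) * r),
      9 / (8 * Cdim) * r ≤ Metric.infDist y (frontier Ω) := by
    intro y hy
    rw [add_mul] at hy
    obtain ⟨z, hz, hyz⟩ := exists_mem_cubeC_dist_le (by positivity) (by positivity) hy
    have h1 := hlow z hz
    have h2 : Metric.infDist z (frontier Ω) ≤ Metric.infDist y (frontier Ω) + dist z y :=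
      Metric.infDist_le_infDist_add_dist
    rw [dist_comm] at hyz
    have h3 : n * (3 * δ * r) ≤ 9 / (8 * Cdim) * r := by
      rw [← mul_assoc]; gcongr
    have h4 : 9 / (4 * Cdim) * r = 9 / (8 * Cdim) * r + 9 / (8 * Cdim) * r := by
      field_simp; norm_num
    linarith
  have hsub : CubeC x ((9 / 8 + 3 * δ) * r) ⊆ Ω := by
    have hx : x ∈ CubeC x ((9 / 8 + 3 * δ) * r) := mem_cubeC_self _ (by positivity)
    refine (convex_cubeC _ _).isPreconnected.subset_of_disjoint_frontier hΩ
      ⟨x, hx, W.subset hQ (W.center_mem hQ)⟩ (disjoint_left.2 fun y hy hyf => ?_)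
    have h1 := hlow' y hy
    rw [Metric.infDist_zero_of_mem hyf] at h1
    have : 0 < 9 / (8 * Cdim) * r := by positivity
    linarith
  refine fun y hy => ⟨hsub hy, hlow' y hy, ?_⟩
  have hne : {d : ℝ | ∃ a ∈ CubeC x (9 / 8 * r), ∃ b ∈ frontier Ω, d = dist a b}.Nonempty :=
    ⟨_, x, mem_cubeC_self _ (by positivity), _, hfr.some_mem, rfl⟩
  obtain ⟨_, ⟨a, ha, b, hb, rfl⟩, hlt⟩ := exists_lt_of_csInf_lt hne
    (lt_of_le_of_lt (W.dist_upper Q hQ) (lt_add_of_pos_right _ hr))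
  have h1 : dist y x ≤ n * (2 * r) :=
    dist_le_of_mem_cubeC (by positivity) (cubeC_subset_cubeC x (by gcongr; linarith) hy)
  have h2 : dist a x ≤ n * (2 * r) :=
    dist_le_of_mem_cubeC (by positivity) (cubeC_subset_cubeC x (by gcongr; norm_num) ha)
  have h3 := dist_triangle4 y x a b
  rw [dist_comm x a] at h3
  have h4 := Metric.infDist_le_dist_of_mem hb (x := y)
  linarith

variable {W} {δ k Λ : ℝ}

theorem Comparable.radius_le (hW : W.Comparable δ k Λ) (hk : 0 < k) {P Q : Set (Rn n)}
    (hP : P ∈ W.cubes) (hQ : Q ∈ W.cubes) {y : Rn n}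
    (hyP : y ∈ CubeC (W.center P) ((9 / 8 + 3 * δ) * W.radius P))
    (hyQ : y ∈ CubeC (W.center Q) ((9 / 8 + 3 * δ) * W.radius Q)) :
    W.radius P ≤ Λ / k * W.radius Q := by
  have h1 := (hW P hP y hyP).2.1
  have h2 := (hW Q hQ y hyQ).2.2
  rw [div_mul_eq_mul_div, le_div_iff₀ hk]
  linarith

theorem Comparable.exists_isCompact (hW : W.Comparable δ k Λ) (hδ : 0 < δ) {Q : Set (Rn n)}
    (hQ : Q ∈ W.cubes) : ∃ K ⊆ Ω, IsCompact K ∧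
      CubeC (W.center Q) ((9 / 8 + 2 * δ) * W.radius Q) ⊆ K := by
  have hr := W.radius_pos Q hQ
  have hb : Bornology.IsBounded (CubeC (W.center Q) ((9 / 8 + 2 * δ) * W.radius Q)) :=
    Metric.isBounded_closedBall.subset (cubeC_subset_closedBall _ (by positivity))
  refine ⟨_, fun y hy => ?_, hb.isCompact_closure, subset_closure⟩
  obtain ⟨z, hz, hyz⟩ := Metric.mem_closure_iff.1 hy (δ * W.radius Q) (by positivity)
  have := cubeC_trans hz (mem_cubeC_of_dist_lt hyz)
  refine (hW Q hQ y ?_).1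
  convert this using 2
  ring

/-- Finitely many of the slightly dilated Whitney cubes have bounded overlap. -/
theorem Comparable.card_filter_le (hW : W.Comparable δ k Λ) (hδ : 0 < δ) (hδ' : δ ≤ 1 / 4)
    (hk : 0 < k) (hΛ : 0 < Λ) (T : Finset (Set (Rn n))) (hT : ∀ Q ∈ T, Q ∈ W.cubes) (y : Rn n)
    [DecidablePred fun Q => y ∈ CubeC (W.center Q) ((9 / 8 + 2 * δ) * W.radius Q)] :
    ((T.filter fun Q => y ∈ CubeC (W.center Q) ((9 / 8 + 2 * δ) * W.radius Q)).card : ℝ) ≤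
      (4 * Λ / k) ^ n := by
  set A := T.filter fun Q => y ∈ CubeC (W.center Q) ((9 / 8 + 2 * δ) * W.radius Q) with hA
  rcases A.eq_empty_or_nonempty with h | ⟨Q₀, hQ₀⟩
  · rw [h]; simp; positivity
  set d := Metric.infDist y (frontier Ω) with hd
  have hmem : ∀ Q ∈ A, Q ∈ W.cubes ∧
      y ∈ CubeC (W.center Q) ((9 / 8 + 3 * δ) * W.radius Q) := fun Q hQ => by
    obtain ⟨h1, h2⟩ := Finset.mem_filter.1 hQ
    have := W.radius_pos Q (hT Q h1)
    exact ⟨hT Q h1, cubeC_subset_cubeC _ (by gcongr; norm_num) h2⟩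
  have hcmp : ∀ Q ∈ A, k * W.radius Q ≤ d ∧ d ≤ Λ * W.radius Q := fun Q hQ =>
    (hW Q (hmem Q hQ).1 y (hmem Q hQ).2).2
  have hd0 : 0 < d := lt_of_lt_of_le (mul_pos hk (W.radius_pos _ (hmem _ hQ₀).1)) (hcmp _ hQ₀).1
  have hsub : ∀ Q ∈ A, Q ⊆ CubeC y (4 * d / k) := by
    intro Q hQ z hz
    have hQc := (hmem Q hQ).1
    have hr := W.radius_pos Q hQc
    rw [W.eq_cube Q hQc] at hz
    have hy := cubeC_subset_cubeC _ (show (9 / 8 + 3 * δ) * W.radius Q ≤ 2 * W.radius Q by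
      gcongr; linarith) (hmem Q hQ).2
    have h4 : 4 * W.radius Q ≤ 4 * d / k := by
      rw [le_div_iff₀ hk]; linarith [(hcmp Q hQ).1]
    exact fun i => ⟨by linarith [(hy i).1, (hy i).2, (hz i).1, (hz i).2],
      by linarith [(hy i).1, (hy i).2, (hz i).1, (hz i).2]⟩
  have hvol : ∑ Q ∈ A, volume Q ≤ volume (CubeC y (4 * d / k)) := by
    rw [← measure_biUnion_finset (f := fun Q => Q) (fun P hP Q hQ hne =>
      W.pairwise_disjoint (hmem P hP).1 (hmem Q hQ).1 hne)
        fun Q hQ => W.measurableSet (hmem Q hQ).1]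
    exact measure_mono (iUnion₂_subset hsub)
  have hvol' : ∀ Q ∈ A, ENNReal.ofReal ((2 * (d / Λ)) ^ n) ≤ volume Q := by
    intro Q hQ
    have hQc := (hmem Q hQ).1
    rw [W.volume_eq hQc, ← ENNReal.ofReal_pow (by linarith [W.radius_pos Q hQc])]
    refine ENNReal.ofReal_le_ofReal (pow_le_pow_left₀ (by positivity) ?_ _)
    gcongr
    rw [div_le_iff₀ hΛ]
    linarith [(hcmp Q hQ).2]
  have h1 := (Finset.card_nsmul_le_sum A _ _ hvol').trans hvol
  rw [volume_cubeC, ← ENNReal.ofReal_pow (by positivity), nsmul_eq_mul, ← ENNReal.ofReal_natCast,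
    ← ENNReal.ofReal_mul (by positivity), ENNReal.ofReal_le_ofReal_iff (by positivity)] at h1
  rw [← le_div_iff₀ (by positivity), ← div_pow] at h1
  have h2 : 2 * (4 * d / k) / (2 * (d / Λ)) = 4 * Λ / k := by field_simp
  rwa [h2] at h1

end WhitneyDecomp

end

section Mass

variable {n : ℕ} {Ω : Set (Rn n)} {w : Rn n → ℝ} {D : ℝ}

theorem wMass_mono {A B : Set (Rn n)} (h : A ⊆ B) : wMass w A ≤ wMass w B :=
  lintegral_mono_set h

theorem wMass_eq_wMeasure (A : Set (Rn n)) : wMass w A = wMeasure w A :=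
  (withDensity_apply' _ _).symm

theorem DoublingIn.wMass_two_pow_le (hw : DoublingIn Ω w D) {x : Rn n} (hx : x ∈ Ω) {r : ℝ}
    (hr : 0 < r) (j : ℕ) :
    wMass w (Ω ∩ CubeC x (2 ^ j * r)) ≤ ENNReal.ofReal D ^ j * wMass w (Ω ∩ CubeC x r) := by
  induction j with
  | zero => simp
  | succ j ih =>
    have h := hw x hx (2 ^ j * r) (by positivity)
    rw [← mul_assoc, ← pow_succ'] at h
    refine h.trans ?_
    rw [pow_succ', mul_assoc]
    exact mul_le_mul_right ih _

end Mass

namespace BomanDecomp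

variable {n : ℕ} {Ω : Set (Rn n)} {Cdim cdim N D : ℝ} (B : BomanDecomp n Ω Cdim cdim N)
  {w : Rn n → ℝ}

theorem wMass_inter_cubeC_le (hw : DoublingIn Ω w D) {R : Set (Rn n)} (hR : R ∈ B.cubes) {s : ℝ}
    {j : ℕ} (hs : s ≤ 2 ^ j) :
    wMass w (Ω ∩ CubeC (B.center R) (s * B.radius R)) ≤ ENNReal.ofReal D ^ j * wMass w R := by
  have hr := B.radius_pos R hR
  have h := hw.wMass_two_pow_le (B.subset hR (B.center_mem hR)) hr j
  rw [← B.eq_cube R hR, inter_eq_right.2 (B.subset hR)] at h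
  exact (wMass_mono (inter_subset_inter_right _ (cubeC_subset_cubeC _ (by gcongr)))).trans h

theorem sum_wMass_le (A : Finset (Set (Rn n))) (hA : ∀ Q ∈ A, Q ∈ B.cubes) {E : Set (Rn n)}
    (hE : ∀ Q ∈ A, Q ⊆ E) : ∑ Q ∈ A, wMass w Q ≤ wMass w E := by
  simp_rw [wMass_eq_wMeasure]
  rw [← measure_biUnion_finset (f := fun Q => Q) (fun P hP Q hQ hne =>
      B.pairwise_disjoint (hA P hP) (hA Q hQ) hne) fun Q hQ => B.measurableSet (hA Q hQ)]
  exact measure_mono (iUnion₂_subset hE)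

open scoped Classical in
theorem sum_shadow_wMass_le (hw : DoublingIn Ω w D) {j : ℕ} (hj : N ≤ 2 ^ j)
    (F : Finset (Set (Rn n))) (hF : ∀ Q ∈ F, Q ∈ B.cubes) {R : Set (Rn n)} (hR : R ∈ B.cubes) :
    ∑ Q ∈ F with R ∈ B.chain Q, wMass w Q ≤ ENNReal.ofReal D ^ j * wMass w R := by
  refine (B.sum_wMass_le _ (fun Q hQ => hF Q (Finset.mem_filter.1 hQ).1) fun Q hQ => ?_).trans
    (B.wMass_inter_cubeC_le hw hR hj)
  obtain ⟨h1, h2⟩ := Finset.mem_filter.1 hQ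
  exact subset_inter (B.subset (hF Q h1)) (B.shadow_subset R hR Q (hF Q h1) h2)

/-- Every finite family of Whitney cubes has a subfamily with disjoint shadows carrying a fixed
proportion of the mass. -/
theorem exists_subfamily_disjoint_shadow (hw : DoublingIn Ω w D) (hN : 1 ≤ N) {j : ℕ}
    (hj : 4 * (n * N) < 2 ^ j) (A : Finset (Set (Rn n))) (hA : ∀ Q ∈ A, Q ∈ B.cubes) :
    ∃ A' ⊆ A, (∀ Q ∈ B.cubes, ∀ R ∈ A', ∀ R' ∈ A', R ∈ B.chain Q → R' ∈ B.chain Q → R = R') ∧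
      ∑ R ∈ A, wMass w R ≤ ENNReal.ofReal D ^ j * ∑ R ∈ A', wMass w R := by
  classical
  have hρ : ∀ R ∈ A, 0 ≤ n * (N * B.radius R) := fun R hR => by
    have := B.radius_pos R (hA R hR)
    positivity
  obtain ⟨t, htA, hdisj, hcov⟩ :=
    Vitali.exists_disjoint_subfamily_covering_enlargement_closedBall (A : Set (Set (Rn n)))
      B.center (fun R => n * (N * B.radius R)) (∑ R ∈ A, n * (N * B.radius R))
      (fun R hR => Finset.single_le_sum (f := fun R => n * (N * B.radius R)) hρ hR) 4 (by norm_num)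
  have hfin : t.Finite := A.finite_toSet.subset htA
  refine ⟨hfin.toFinset, by simpa using htA, fun Q hQ R hR R' hR' hRQ hRQ' => ?_, ?_⟩
  · have hR := hfin.mem_toFinset.1 hR
    have hR' := hfin.mem_toFinset.1 hR'
    have hmem : ∀ P ∈ t, P ∈ B.chain Q →
        B.center Q ∈ Metric.closedBall (B.center P) (n * (N * B.radius P)) := by
      intro P hP hPQ
      have hPc := hA P (htA hP)
      have := B.radius_pos P hPc
      exact cubeC_subset_closedBall _ (by positivity)
        (B.shadow_subset P hPc Q hQ hPQ (B.center_mem hQ))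
    by_contra hne
    exact disjoint_left.1 (hdisj hR hR' hne) (hmem R hR hRQ) (hmem R' hR' hRQ')
  · calc ∑ R ∈ A, wMass w R
        ≤ wMass w (⋃ R ∈ hfin.toFinset,
            Ω ∩ CubeC (B.center R) (2 ^ j * B.radius R)) := by
          refine B.sum_wMass_le A hA fun R hR z hz => ?_
          obtain ⟨P, hP, hRP⟩ := hcov R hR
          have hrR := B.radius_pos R (hA R hR)
          have hrP := B.radius_pos P (hA P (htA hP))
          have h1 : z ∈ Metric.closedBall (B.center R) (n * (N * B.radius R)) := by
            refine cubeC_subset_closedBall _ (by positivity) ?_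
            rw [B.eq_cube R (hA R hR)] at hz
            exact cubeC_subset_cubeC _ (le_mul_of_one_le_left hrR.le hN) hz
          have h2 := Metric.mem_closedBall.1 (hRP h1)
          refine mem_iUnion₂.2 ⟨P, hfin.mem_toFinset.2 hP, B.subset (hA R hR) hz,
            mem_cubeC_of_dist_lt (h2.trans_lt ?_)⟩
          calc 4 * (n * (N * B.radius P)) = 4 * (n * N) * B.radius P := by ring
            _ < _ := by gcongr
      _ ≤ ∑ R ∈ hfin.toFinset, wMass w (Ω ∩ CubeC (B.center R) (2 ^ j * B.radius R)) := by
          simp_rw [wMass_eq_wMeasure]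
          exact measure_biUnion_finset_le _ _
      _ ≤ ∑ R ∈ hfin.toFinset, ENNReal.ofReal D ^ j * wMass w R :=
          Finset.sum_le_sum fun R hR =>
            B.wMass_inter_cubeC_le hw (hA R (htA (hfin.mem_toFinset.1 hR))) le_rfl
      _ = _ := (Finset.mul_sum _ _ _).symm

end BomanDecomp

theorem edist_le_two_mul_sum_of_isChain {X : Type*} {rel : X → X → Prop} {s : Set X} {c : X → ℝ}
    {a : X → ℝ≥0∞} (h : ∀ P ∈ s, ∀ Q ∈ s, rel P Q → edist (c P) (c Q) ≤ a P + a Q) :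
    ∀ l : List X, (∀ R ∈ l, R ∈ s) → l.IsChain rel → ∀ P Q, l.head? = some P →
      l.getLast? = some Q → edist (c P) (c Q) + a P ≤ 2 * (l.map a).sum
  | [], _, _, P, Q, hP, _ => by simp at hP
  | [x], _, _, P, Q, hP, hQ => by
    simp only [List.head?_cons, List.getLast?_singleton, Option.some.injEq] at hP hQ
    subst hP hQ
    simpa using le_mul_of_one_le_left zero_le one_le_two
  | x :: y :: t, hmem, hch, P, Q, hP, hQ => by
    simp only [List.head?_cons, Option.some.injEq] at hP
    subst hP
    rw [List.isChain_cons_cons] at hch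
    have ih := edist_le_two_mul_sum_of_isChain h (y :: t)
      (fun R hR => hmem R (List.mem_cons_of_mem _ hR)) hch.2 y Q rfl (by simpa using hQ)
    have hxy := h x (hmem x (by simp)) y (hmem y (by simp)) hch.1
    calc edist (c x) (c Q) + a x ≤ edist (c x) (c y) + edist (c y) (c Q) + a x := by
          gcongr; exact edist_triangle _ _ _
      _ ≤ (a x + a y) + edist (c y) (c Q) + a x := by gcongr
      _ = 2 * a x + (edist (c y) (c Q) + a y) := by ring
      _ ≤ 2 * a x + 2 * ((y :: t).map a).sum := by gcongr
      _ = _ := by simp [mul_add]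

theorem ENNReal.sum_rpow_le_rpow_sum {ι : Type*} (s : Finset ι) (f : ι → ℝ≥0∞) {p : ℝ}
    (hp : 1 ≤ p) : ∑ i ∈ s, f i ^ p ≤ (∑ i ∈ s, f i) ^ p := by
  classical
  induction s using Finset.induction_on with
  | empty => simp [ENNReal.zero_rpow_of_pos (by linarith : 0 < p)]
  | insert i s hi ih =>
    rw [Finset.sum_insert hi, Finset.sum_insert hi]
    exact (add_le_add_right ih _).trans (ENNReal.add_rpow_le_rpow_add _ _ hp)

namespace BomanDecomp

variable {n : ℕ} {Ω : Set (Rn n)} {Cdim cdim N D : ℝ} (B : BomanDecomp n Ω Cdim cdim N)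
  {w : Rn n → ℝ}

/-- Sums along Boman chains are controlled in a weighted `ℓ^q`. -/
theorem sum_wMass_mul_chain_sum_le (hw : DoublingIn Ω w D) (hD : 0 < D) (hN : 1 ≤ N) (hn : 0 < n)
    {j : ℕ} (hj : 4 * (n * N) < 2 ^ j) {q : ℝ} (hq : 1 < q)
    (hw0 : ∀ Q ∈ B.cubes, wMass w Q ≠ 0) (hwt : ∀ Q ∈ B.cubes, wMass w Q ≠ ⊤)
    {F T : Finset (Set (Rn n))} (hF : ∀ Q ∈ F, Q ∈ B.cubes) (hT : ∀ Q ∈ T, Q ∈ B.cubes)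
    (hFT : ∀ Q ∈ F, ∀ R ∈ B.chain Q, R ∈ T) {a : Set (Rn n) → ℝ≥0∞} (ha : ∀ R ∈ T, a R ≠ ⊤) :
    ∑ Q ∈ F, wMass w Q * ((B.chain Q).map a).sum ^ q ≤
      ENNReal.ofReal ((2 * D ^ j * q * (2 * D ^ j) ^ (1 / (q - 1))) ^ (q - 1)) *
        ∑ R ∈ T, wMass w R * a R ^ q := by
  classical
  set m : Set (Rn n) → ℝ := fun R => (wMass w R).toReal with hm
  have hm0 : ∀ R ∈ B.cubes, 0 < m R := fun R hR => ENNReal.toReal_pos (hw0 R hR) (hwt R hR)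
  have hmof : ∀ R ∈ B.cubes, wMass w R = ENNReal.ofReal (m R) := fun R hR =>
    (ENNReal.ofReal_toReal (hwt R hR)).symm
  have hsum : ∀ A : Finset (Set (Rn n)), (∀ R ∈ A, R ∈ B.cubes) →
      ∑ R ∈ A, wMass w R = ENNReal.ofReal (∑ R ∈ A, m R) := fun A hA => by
    rw [ENNReal.ofReal_sum_of_nonneg fun R hR => (hm0 R (hA R hR)).le]
    exact Finset.sum_congr rfl fun R hR => hmof R (hA R hR)
  have hNj : N ≤ 2 ^ j := by
    have : (1 : ℝ) ≤ n := by exact_mod_cast hn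
    nlinarith
  have key := sum_mul_chain_sum_rpow_le F T (fun Q => (B.chain Q).toFinset)
    (fun Q hQ R hR => hFT Q hQ R (List.mem_toFinset.1 hR)) (m := m) (a := fun R => (a R).toReal)
    (fun R hR => hm0 R (hT R hR)) (fun Q hQ => (hm0 Q (hF Q hQ)).le)
    (fun R _ => ENNReal.toReal_nonneg) (K := D ^ j) (L := D ^ j) (by positivity) (by positivity) hq
    (fun A hA => by
      have hAc : ∀ R ∈ A, R ∈ B.cubes := fun R hR => hT R (hA hR)
      obtain ⟨A', hA', hdisj, hle⟩ := B.exists_subfamily_disjoint_shadow hw hN hj A hAc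
      refine ⟨A', hA', fun Q hQ R hR R' hR' h h' => hdisj Q (hF Q hQ) R hR R' hR'
        (List.mem_toFinset.1 h) (List.mem_toFinset.1 h'), ?_⟩
      have hA'c : ∀ R ∈ A', R ∈ B.cubes := fun R hR => hAc R (hA' hR)
      have h0 : 0 ≤ ∑ R ∈ A', m R := Finset.sum_nonneg fun R hR => (hm0 R (hA'c R hR)).le
      rwa [hsum A hAc, hsum A' hA'c, ← ENNReal.ofReal_pow hD.le,
        ← ENNReal.ofReal_mul (by positivity), ENNReal.ofReal_le_ofReal_iff (by positivity)] at hle)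
    (fun R hR => by
      have hle := B.sum_shadow_wMass_le hw hNj F hF (hT R hR)
      have h0 := hm0 R (hT R hR)
      rw [hsum _ fun Q hQ => hF Q (Finset.mem_filter.1 hQ).1, hmof R (hT R hR),
        ← ENNReal.ofReal_pow hD.le, ← ENNReal.ofReal_mul (by positivity),
        ENNReal.ofReal_le_ofReal_iff (by positivity)] at hle
      simpa using hle)
  have hq0 : 0 ≤ q := by linarith
  have hL : ∑ Q ∈ F, wMass w Q * ((B.chain Q).map a).sum ^ q =
      ENNReal.ofReal (∑ Q ∈ F, m Q * (∑ R ∈ (B.chain Q).toFinset, (a R).toReal) ^ q) := by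
    rw [ENNReal.ofReal_sum_of_nonneg fun Q hQ => mul_nonneg (hm0 Q (hF Q hQ)).le
      (Real.rpow_nonneg (Finset.sum_nonneg fun _ _ => ENNReal.toReal_nonneg) _)]
    refine Finset.sum_congr rfl fun Q hQ => ?_
    rw [ENNReal.ofReal_mul (hm0 Q (hF Q hQ)).le, ← hmof Q (hF Q hQ),
      ← ENNReal.ofReal_rpow_of_nonneg (Finset.sum_nonneg fun _ _ => ENNReal.toReal_nonneg) hq0,
      ENNReal.ofReal_sum_of_nonneg fun _ _ => ENNReal.toReal_nonneg,
      ← List.sum_toFinset a (B.chain_isChain Q (hF Q hQ)).2.1]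
    congr 2
    exact Finset.sum_congr rfl fun R hR =>
      (ENNReal.ofReal_toReal (ha R (hFT Q hQ R (List.mem_toFinset.1 hR)))).symm
  have hR : ∑ R ∈ T, wMass w R * a R ^ q =
      ENNReal.ofReal (∑ R ∈ T, m R * (a R).toReal ^ q) := by
    rw [ENNReal.ofReal_sum_of_nonneg fun R hR => mul_nonneg (hm0 R (hT R hR)).le
      (Real.rpow_nonneg ENNReal.toReal_nonneg _)]
    refine Finset.sum_congr rfl fun R hR => ?_
    rw [ENNReal.ofReal_mul (hm0 R (hT R hR)).le, ← hmof R (hT R hR),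
      ← ENNReal.ofReal_rpow_of_nonneg ENNReal.toReal_nonneg hq0, ENNReal.ofReal_toReal (ha R hR)]
  rw [hL, hR, ← ENNReal.ofReal_mul (by positivity)]
  exact ENNReal.ofReal_le_ofReal key

end BomanDecomp

section

open scoped Topology

theorem continuousOn_of_lipschitzOnWith_compact {E : Type*} [PseudoMetricSpace E] [ProperSpace E]
    {Ω : Set E} (hΩ : IsOpen Ω) {u : E → ℝ}
    (hu : ∀ K : Set E, K ⊆ Ω → IsCompact K → ∃ L : ℝ≥0, LipschitzOnWith L u K) :
    ContinuousOn u Ω := by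
  intro x hx
  obtain ⟨ε, hε, hsub⟩ := Metric.nhds_basis_closedBall.mem_iff.1 (hΩ.mem_nhds hx)
  obtain ⟨L, hL⟩ := hu _ hsub (isCompact_closedBall x ε)
  exact (hL.continuousOn.continuousAt (Metric.closedBall_mem_nhds x hε)).continuousWithinAt

namespace WhitneyDecomp.Comparable

variable {n : ℕ} {Ω : Set (Rn n)} {Cdim : ℝ} {W : WhitneyDecomp n Ω Cdim} {δ k Λ γ : ℝ}

theorem ofReal_infDist_rpow_le (hW : W.Comparable δ k Λ) (hδ : 0 < δ) (hk : 0 < k) (hγ : γ ≤ 0)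
    {Q : Set (Rn n)} (hQ : Q ∈ W.cubes) {y : Rn n} (hy : y ∈ Q) :
    ENNReal.ofReal (Metric.infDist y (frontier Ω) ^ γ) ≤
      ENNReal.ofReal k ^ γ * ENNReal.ofReal (W.radius Q) ^ γ := by
  have hr := W.radius_pos Q hQ
  rw [W.eq_cube Q hQ] at hy
  have h := (hW Q hQ y (cubeC_subset_cubeC _
    (le_mul_of_one_le_left hr.le (by linarith)) hy)).2.1
  rw [ENNReal.ofReal_rpow_of_pos hk, ENNReal.ofReal_rpow_of_pos hr,
    ← ENNReal.ofReal_mul (by positivity), ← Real.mul_rpow hk.le hr.le]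
  exact ENNReal.ofReal_le_ofReal (Real.rpow_le_rpow_of_nonpos (by positivity) h hγ)

theorem wMass_le (hW : W.Comparable δ k Λ) (hδ : 0 < δ) (hk : 0 < k) (hγ : γ ≤ 0)
    {Q : Set (Rn n)} (hQ : Q ∈ W.cubes) :
    wMass (fun y => Metric.infDist y (frontier Ω) ^ γ) Q ≤
      ENNReal.ofReal k ^ γ * 2 ^ n * ENNReal.ofReal (W.radius Q) ^ (γ + n) := by
  have hr := W.radius_pos Q hQ
  calc wMass (fun y => Metric.infDist y (frontier Ω) ^ γ) Q
      ≤ ∫⁻ _ in Q, ENNReal.ofReal k ^ γ * ENNReal.ofReal (W.radius Q) ^ γ :=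
        setLIntegral_mono measurable_const fun y hy => hW.ofReal_infDist_rpow_le hδ hk hγ hQ hy
    _ = _ := by
        rw [setLIntegral_const, W.volume_eq hQ, ENNReal.ofReal_mul (by norm_num), mul_pow,
          ENNReal.rpow_add _ _ (by simpa using hr) ENNReal.ofReal_ne_top, ENNReal.rpow_natCast]
        simp
        ring

theorem wMass_ne_top (hW : W.Comparable δ k Λ) (hδ : 0 < δ) (hk : 0 < k) (hγ : γ ≤ 0)
    {Q : Set (Rn n)} (hQ : Q ∈ W.cubes) :
    wMass (fun y => Metric.infDist y (frontier Ω) ^ γ) Q ≠ ⊤ := by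
  refine ne_top_of_le_ne_top ?_ (hW.wMass_le hδ hk hγ hQ)
  rw [ENNReal.ofReal_rpow_of_pos hk, ENNReal.ofReal_rpow_of_pos (W.radius_pos Q hQ)]
  finiteness

theorem wMass_ne_zero (hW : W.Comparable δ k Λ) (hδ : 0 < δ) (hk : 0 < k)
    {Q : Set (Rn n)} (hQ : Q ∈ W.cubes) :
    wMass (fun y => Metric.infDist y (frontier Ω) ^ γ) Q ≠ 0 := by
  have hr := W.radius_pos Q hQ
  have hm : Measurable fun y => ENNReal.ofReal (Metric.infDist y (frontier Ω) ^ γ) :=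
    (Metric.continuous_infDist_pt _).measurable.pow_const _ |>.ennreal_ofReal
  have hpos : 0 < wMass (fun y => Metric.infDist y (frontier Ω) ^ γ) Q := by
    refine (setLIntegral_pos_iff hm).2 ?_
    refine lt_of_lt_of_le ?_ (measure_mono (subset_inter (fun y hy => ?_) (Subset.refl Q)))
    · rw [W.volume_eq hQ]
      exact ENNReal.pow_pos (by simpa using hr) n
    · rw [W.eq_cube Q hQ] at hy
      have h := (hW Q hQ y (cubeC_subset_cubeC _
        (le_mul_of_one_le_left hr.le (by linarith)) hy)).2.1
      have : 0 < Metric.infDist y (frontier Ω) := lt_of_lt_of_le (by positivity) h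
      simpa using Real.rpow_pos_of_pos this γ
  exact ne_of_gt hpos

/-- Approximating constants on overlapping slightly dilated Whitney cubes are close. -/
theorem edist_rpow_le (hW : W.Comparable δ k Λ) (hδ : 0 < δ) (hk : 0 < k) (hΛ : 0 < Λ)
    {q : ℝ} (hq : 1 ≤ q) {u : Rn n → ℝ} (hu : ContinuousOn u Ω) {c : Set (Rn n) → ℝ}
    {I : Set (Rn n) → ℝ≥0∞}
    (hloc : ∀ Q ∈ W.cubes, ∫⁻ z in CubeC (W.center Q) ((9 / 8 + δ) * W.radius Q),
      ‖u z - c Q‖ₑ ^ q ≤ ENNReal.ofReal (W.radius Q) ^ n * I Q)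
    {P Q : Set (Rn n)} (hP : P ∈ W.cubes) (hQ : Q ∈ W.cubes) {z : Rn n}
    (hzP : z ∈ Qstar W P) (hzQ : z ∈ Qstar W Q) :
    edist (c P) (c Q) ^ q ≤
      2 ^ (q - 1) * ENNReal.ofReal (Λ / (2 * δ * k)) ^ n * (I P + I Q) := by
  have hrP := W.radius_pos P hP
  have hrQ := W.radius_pos Q hQ
  set ρ : ℝ := δ * min (W.radius P) (W.radius Q) with hρ
  have hρ0 : 0 < ρ := by positivity
  have hbig : ∀ R ∈ W.cubes, z ∈ Qstar W R →
      z ∈ CubeC (W.center R) ((9 / 8 + 3 * δ) * W.radius R) := fun R hR hz => by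
    have := W.radius_pos R hR
    exact cubeC_subset_cubeC _ (by gcongr; linarith) hz
  have hcube : ∀ R ∈ W.cubes, z ∈ Qstar W R → ρ ≤ δ * W.radius R →
      CubeC z ρ ⊆ CubeC (W.center R) ((9 / 8 + δ) * W.radius R) := fun R hR hz hle y hy => by
    rw [add_mul]
    exact cubeC_trans hz (cubeC_subset_cubeC _ hle hy)
  have hρP : ρ ≤ δ * W.radius P := mul_le_mul_of_nonneg_left (min_le_left _ _) hδ.le
  have hρQ : ρ ≤ δ * W.radius Q := mul_le_mul_of_nonneg_left (min_le_right _ _) hδ.le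
  have h1 : W.radius P ≤ Λ / k * W.radius Q := hW.radius_le hk hP hQ (hbig P hP hzP) (hbig Q hQ hzQ)
  have h2 : W.radius Q ≤ Λ / k * W.radius P := hW.radius_le hk hQ hP (hbig Q hQ hzQ) (hbig P hP hzP)
  have h3 : W.radius P ≤ Λ / k * W.radius P := hW.radius_le hk hP hP (hbig P hP hzP) (hbig P hP hzP)
  have h4 : W.radius Q ≤ Λ / k * W.radius Q := hW.radius_le hk hQ hQ (hbig Q hQ hzQ) (hbig Q hQ hzQ)
  have hρeq : Λ / (2 * δ * k) * (2 * ρ) = Λ / k * min (W.radius P) (W.radius Q) := by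
    rw [hρ]; field_simp
  have hP' : ENNReal.ofReal (W.radius P) ≤
      ENNReal.ofReal (Λ / (2 * δ * k)) * ENNReal.ofReal (2 * ρ) := by
    rw [← ENNReal.ofReal_mul (by positivity), hρeq]
    refine ENNReal.ofReal_le_ofReal ?_
    rcases min_choice (W.radius P) (W.radius Q) with h | h <;> rw [h] <;> assumption
  have hQ' : ENNReal.ofReal (W.radius Q) ≤
      ENNReal.ofReal (Λ / (2 * δ * k)) * ENNReal.ofReal (2 * ρ) := by
    rw [← ENNReal.ofReal_mul (by positivity), hρeq]
    refine ENNReal.ofReal_le_ofReal ?_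
    rcases min_choice (W.radius P) (W.radius Q) with h | h <;> rw [h] <;> assumption
  have hsubΩ : CubeC z ρ ⊆ Ω := fun y hy => (hW P hP y (cubeC_subset_cubeC _
    (by gcongr; linarith) (hcube P hP hzP hρP hy))).1
  have hum : AEMeasurable u (volume.restrict (CubeC z ρ)) :=
    (hu.mono hsubΩ).aemeasurable (measurableSet_cubeC _ _)
  have hmain : ENNReal.ofReal (2 * ρ) ^ n * edist (c P) (c Q) ^ q ≤ ENNReal.ofReal (2 * ρ) ^ n *
      (2 ^ (q - 1) * ENNReal.ofReal (Λ / (2 * δ * k)) ^ n * (I P + I Q)) := by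
    calc ENNReal.ofReal (2 * ρ) ^ n * edist (c P) (c Q) ^ q
        = ∫⁻ _ in CubeC z ρ, ‖c P - c Q‖ₑ ^ q := by
          rw [setLIntegral_const, volume_cubeC, edist_eq_enorm_sub, mul_comm]
      _ ≤ ∫⁻ y in CubeC z ρ, 2 ^ (q - 1) * (‖u y - c P‖ₑ ^ q + ‖u y - c Q‖ₑ ^ q) := by
          refine lintegral_mono fun y => ?_
          have := enorm_sub_rpow_le_two_rpow_mul hq (c P) (c Q) (u y)
          rwa [← enorm_neg (c P - u y), ← enorm_neg (c Q - u y), neg_sub, neg_sub] at this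
      _ = 2 ^ (q - 1) * ((∫⁻ y in CubeC z ρ, ‖u y - c P‖ₑ ^ q) +
            ∫⁻ y in CubeC z ρ, ‖u y - c Q‖ₑ ^ q) := by
          rw [lintegral_const_mul' _ _ (by finiteness), lintegral_add_left' (by fun_prop)]
      _ ≤ 2 ^ (q - 1) * ((ENNReal.ofReal (Λ / (2 * δ * k)) * ENNReal.ofReal (2 * ρ)) ^ n * I P +
            (ENNReal.ofReal (Λ / (2 * δ * k)) * ENNReal.ofReal (2 * ρ)) ^ n * I Q) := by
          gcongr
          · exact ((lintegral_mono_set (hcube P hP hzP hρP)).trans (hloc P hP)).trans (by gcongr)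
          · exact ((lintegral_mono_set (hcube Q hQ hzQ hρQ)).trans (hloc Q hQ)).trans (by gcongr)
      _ = _ := by ring
  refine (ENNReal.mul_le_mul_iff_right ?_ ?_).1 hmain
  · exact pow_ne_zero _ (by simpa using hρ0)
  · finiteness

end WhitneyDecomp.Comparable

end

section

open scoped Topology

namespace WhitneyDecomp

variable {n : ℕ} {Ω : Set (Rn n)} {Cdim : ℝ} {W : WhitneyDecomp n Ω Cdim} {δ k Λ : ℝ}

theorem Comparable.sum_setLIntegral_le (hW : W.Comparable δ k Λ) (hδ : 0 < δ) (hδ' : δ ≤ 1 / 4)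
    (hk : 0 < k) (hΛ : 0 < Λ) (T : Finset (Set (Rn n)))
    (hT : ∀ Q ∈ T, Q ∈ W.cubes) {f : Rn n → ℝ≥0∞} (hf : Measurable f) :
    ∑ Q ∈ T, ∫⁻ z in CubeC (W.center Q) ((9 / 8 + 2 * δ) * W.radius Q), f z ≤
      ENNReal.ofReal ((4 * Λ / k) ^ n) * ∫⁻ z in Ω, f z := by
  classical
  have hsub : ∀ Q ∈ T, CubeC (W.center Q) ((9 / 8 + 2 * δ) * W.radius Q) ⊆ Ω :=
    fun Q hQ y hy => by
      have := W.radius_pos Q (hT Q hQ)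
      exact (hW Q (hT Q hQ) y (cubeC_subset_cubeC _ (by gcongr; norm_num) hy)).1
  have hm : ∀ Q, MeasurableSet (CubeC (W.center Q) ((9 / 8 + 2 * δ) * W.radius Q)) :=
    fun Q => measurableSet_cubeC _ _
  calc ∑ Q ∈ T, ∫⁻ z in CubeC (W.center Q) ((9 / 8 + 2 * δ) * W.radius Q), f z
      = ∑ Q ∈ T, ∫⁻ z in Ω,
          (CubeC (W.center Q) ((9 / 8 + 2 * δ) * W.radius Q)).indicator f z := by
        refine Finset.sum_congr rfl fun Q hQ => ?_
        rw [setLIntegral_indicator (hm Q), inter_eq_left.2 (hsub Q hQ)]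
    _ = ∫⁻ z in Ω, ∑ Q ∈ T,
          (CubeC (W.center Q) ((9 / 8 + 2 * δ) * W.radius Q)).indicator f z :=
        (lintegral_finsetSum _ fun Q _ => hf.indicator (hm Q)).symm
    _ ≤ ∫⁻ z in Ω, ENNReal.ofReal ((4 * Λ / k) ^ n) * f z := by
        refine lintegral_mono fun z => ?_
        simp_rw [indicator_apply]
        rw [← Finset.sum_filter, Finset.sum_const, nsmul_eq_mul, ← ENNReal.ofReal_natCast]
        gcongr
        exact hW.card_filter_le hδ hδ' hk hΛ T hT z
    _ = _ := lintegral_const_mul _ hf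

theorem setLIntegral_le_of_forall_finset_sum_le (W : WhitneyDecomp n Ω Cdim) {f : Rn n → ℝ≥0∞}
    {C : ℝ≥0∞} (h : ∀ F : Finset (Set (Rn n)), (∀ Q ∈ F, Q ∈ W.cubes) →
      ∑ Q ∈ F, ∫⁻ z in Q, f z ≤ C) : ∫⁻ z in Ω, f z ≤ C := by
  have hΩ : Ω = ⋃ Q ∈ W.cubes, Q := by rw [← sUnion_eq_biUnion, W.union_eq]
  rw [hΩ, lintegral_biUnion (s := fun Q => Q) W.countable (fun Q hQ => W.measurableSet hQ)
    W.pairwise_disjoint, ENNReal.tsum_eq_iSup_sum]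
  refine iSup_le fun S => ?_
  have := h (S.map (Function.Embedding.subtype _)) fun R hR => by
    obtain ⟨Q, -, rfl⟩ := Finset.mem_map.1 hR
    exact Q.2
  rwa [Finset.sum_map] at this

/-- On every Whitney cube a locally Lipschitz function is close to a constant. -/
theorem exists_local_poincare (n : ℕ) {p q δ : ℝ} (hp : 1 < p) (hpq : p ≤ q) (hpn : p < n)
    (hq : q ≤ n * p / (n - p)) (hδ : 0 < δ) (hδ' : δ ≤ 1 / 4)
    (hγ : -(n : ℝ) + q / p * (n - p) ≤ 0) :
    ∃ C : ℝ≥0∞, C ≠ ⊤ ∧ ∀ (Ω : Set (Rn n)) (Cdim : ℝ) (W : WhitneyDecomp n Ω Cdim) (k Λ : ℝ),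
      W.Comparable δ k Λ → ∀ u : Rn n → ℝ,
      (∀ K : Set (Rn n), K ⊆ Ω → IsCompact K → ∃ L : ℝ≥0, LipschitzOnWith L u K) →
      ∀ Q ∈ W.cubes, ∃ c : ℝ,
        ∫⁻ z in CubeC (W.center Q) ((9 / 8 + δ) * W.radius Q), ‖u z - c‖ₑ ^ q ≤
          C * ENNReal.ofReal (W.radius Q) ^ (-(-(n : ℝ) + q / p * (n - p))) *
            (∫⁻ z in CubeC (W.center Q) ((9 / 8 + 2 * δ) * W.radius Q),
              ‖fderiv ℝ u z‖ₑ ^ p) ^ (q / p) := by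
  have h0 : 0 < 9 / 8 + δ := by positivity
  obtain ⟨C, hC⟩ := exists_sobolev_poincare_cubeC n hp hpq hpn hq
    (show 1 < (9 / 8 + 2 * δ) / (9 / 8 + δ) by rw [lt_div_iff₀ h0]; linarith)
  set γ : ℝ := -(n : ℝ) + q / p * (n - p) with hγdef
  refine ⟨C * 2 ^ (-γ), ENNReal.mul_ne_top ENNReal.coe_ne_top
    (ENNReal.rpow_ne_top_of_nonneg (by linarith) (by norm_num)), ?_⟩
  intro Ω Cdim W k Λ hW u hu Q hQ
  have hr := W.radius_pos Q hQ
  obtain ⟨K, hKΩ, hK, hsub⟩ := hW.exists_isCompact hδ hQ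
  obtain ⟨L, hL⟩ := hu K hKΩ hK
  have heq : (9 / 8 + δ) * W.radius Q * ((9 / 8 + 2 * δ) / (9 / 8 + δ)) =
      (9 / 8 + 2 * δ) * W.radius Q := by field_simp
  obtain ⟨c, hc⟩ := hC (W.center Q) ((9 / 8 + δ) * W.radius Q) (by positivity) u L
    (by rw [heq]; exact hL.mono hsub)
  rw [heq] at hc
  refine ⟨c, hc.trans ?_⟩
  refine mul_le_mul_left ?_ _
  rw [mul_assoc, show (n : ℝ) - q / p * (n - p) = -γ by rw [hγdef]; ring]
  refine mul_le_mul_right ?_ _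
  rw [← ENNReal.mul_rpow_of_nonneg _ _ (by linarith)]
  refine ENNReal.rpow_le_rpow ?_ (by linarith)
  rw [← ENNReal.ofReal_ofNat, ← ENNReal.ofReal_mul (by norm_num)]
  exact ENNReal.ofReal_le_ofReal (by gcongr; linarith)

end WhitneyDecomp

/-- The weighted Poincaré inequality in unnormalized form, for functions of finite energy. -/
theorem exists_weighted_poincare (n : ℕ) {p q D N Cdim : ℝ} (cdim : ℝ) (hp : 1 < p) (hpq : p ≤ q)
    (hpn : p < n) (hq : q ≤ n * p / (n - p)) (hD : 0 < D) (hN : 1 ≤ N) (hCdim : 0 < Cdim) :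
    ∃ C : ℝ≥0∞, C ≠ ⊤ ∧ ∀ (Ω : Set (Rn n)), IsOpen Ω → ∀ _B : BomanDecomp n Ω Cdim cdim N,
      DoublingIn Ω
        (fun x => Metric.infDist x (frontier Ω) ^ (-(n : ℝ) + q / p * (n - p))) D →
      ∀ u : Rn n → ℝ,
      (∀ K : Set (Rn n), K ⊆ Ω → IsCompact K → ∃ L : ℝ≥0, LipschitzOnWith L u K) →
      ∫⁻ x in Ω, ‖fderiv ℝ u x‖ₑ ^ p ≠ ⊤ → ∃ c : ℝ,
      ∫⁻ x in Ω, ‖u x - c‖ₑ ^ q *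
          ENNReal.ofReal (Metric.infDist x (frontier Ω) ^ (-(n : ℝ) + q / p * (n - p))) ≤
        C * (∫⁻ x in Ω, ‖fderiv ℝ u x‖ₑ ^ p) ^ (q / p) := by
  classical
  have hp0 : 0 < p := by linarith
  have hq1 : 1 < q := by linarith
  have hq0 : 0 < q := by linarith
  have hn : 0 < n := by
    have : (0 : ℝ) < n := by linarith
    exact_mod_cast this
  have hs : 1 ≤ q / p := (one_le_div hp0).2 hpq
  have hs0 : 0 ≤ q / p := by linarith
  have hγ : -(n : ℝ) + q / p * (n - p) ≤ 0 := by
    rw [le_div_iff₀ (by linarith)] at hq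
    rw [div_mul_eq_mul_div, neg_add_nonpos_iff, div_le_iff₀ hp0]
    exact hq
  obtain ⟨δ, k, Λ, hδ, hδ', hk, hΛ, hcomp⟩ :=
    WhitneyDecomp.exists_comparable (n := n) hn hCdim
  obtain ⟨C₁, hC₁, hlocal⟩ :=
    WhitneyDecomp.exists_local_poincare n hp hpq hpn hq hδ hδ' hγ
  obtain ⟨j, hj⟩ := pow_unbounded_of_one_lt (4 * (n * N)) (one_lt_two (α := ℝ))
  set γ : ℝ := -(n : ℝ) + q / p * (n - p) with hγdef
  set κ : ℝ≥0∞ := ENNReal.ofReal k ^ γ with hκ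
  have hκt : κ ≠ ⊤ := by rw [hκ, ENNReal.ofReal_rpow_of_pos hk]; finiteness
  set A : ℝ≥0∞ := 2 ^ (q - 1) * ENNReal.ofReal (Λ / (2 * δ * k)) ^ n with hA
  have hAt : A ≠ ⊤ := ENNReal.mul_ne_top
    (ENNReal.rpow_ne_top_of_nonneg (by linarith) (by norm_num)) (by finiteness)
  set b : ℝ≥0∞ := ENNReal.ofReal ((2 * D ^ j * q * (2 * D ^ j) ^ (1 / (q - 1))) ^ (q - 1)) with hb
  set M : ℝ≥0∞ := ENNReal.ofReal ((4 * Λ / k) ^ n) with hM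
  refine ⟨2 ^ (q - 1) * (κ * C₁ + 2 ^ q * (b * (A * (κ * 2 ^ n * C₁)))) * M ^ (q / p), ?_, ?_⟩
  · have h2 : (2 : ℝ≥0∞) ^ (q - 1) ≠ ⊤ := ENNReal.rpow_ne_top_of_nonneg (by linarith) (by norm_num)
    have h3 : (2 : ℝ≥0∞) ^ q ≠ ⊤ := ENNReal.rpow_ne_top_of_nonneg (by linarith) (by norm_num)
    have h4 : M ^ (q / p) ≠ ⊤ := ENNReal.rpow_ne_top_of_nonneg hs0 ENNReal.ofReal_ne_top
    finiteness
  intro Ω hΩ B hdoub u hu hfin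
  have hW := hcomp Ω hΩ B.toWhitneyDecomp
  have hcont := continuousOn_of_lipschitzOnWith_compact hΩ hu
  have hex : ∀ Q, ∃ c : ℝ, Q ∈ B.cubes →
      ∫⁻ z in CubeC (B.center Q) ((9 / 8 + δ) * B.radius Q), ‖u z - c‖ₑ ^ q ≤
          C₁ * ENNReal.ofReal (B.radius Q) ^ (-γ) *
            (∫⁻ z in CubeC (B.center Q) ((9 / 8 + 2 * δ) * B.radius Q),
              ‖fderiv ℝ u z‖ₑ ^ p) ^ (q / p) := fun Q => by
    by_cases hQ : Q ∈ B.cubes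
    · obtain ⟨c, hc⟩ := hlocal Ω Cdim B.toWhitneyDecomp k Λ hW u hu Q hQ
      exact ⟨c, fun _ => hc⟩
    · exact ⟨0, fun h => absurd h hQ⟩
  choose c hc using hex
  set G : Set (Rn n) → ℝ≥0∞ := fun Q =>
    ∫⁻ z in CubeC (B.center Q) ((9 / 8 + 2 * δ) * B.radius Q), ‖fderiv ℝ u z‖ₑ ^ p with hG
  set r : Set (Rn n) → ℝ≥0∞ := fun Q => ENNReal.ofReal (B.radius Q) with hr
  have hr0 : ∀ Q ∈ B.cubes, r Q ≠ 0 := fun Q hQ => by simpa [hr] using B.radius_pos Q hQ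
  have hrt : ∀ Q, r Q ≠ ⊤ := fun Q => ENNReal.ofReal_ne_top
  set I : Set (Rn n) → ℝ≥0∞ := fun Q => C₁ * r Q ^ (-γ - n) * G Q ^ (q / p) with hI
  set w : Rn n → ℝ := fun x => Metric.infDist x (frontier Ω) ^ γ with hw
  have hwm : Measurable fun x => ENNReal.ofReal (w x) :=
    ((Metric.continuous_infDist_pt _).measurable.pow_const _).ennreal_ofReal
  have hfm : Measurable fun z => ‖fderiv ℝ u z‖ₑ ^ p :=
    (measurable_fderiv ℝ u).enorm.pow_const _
  have hGsum : ∀ T : Finset (Set (Rn n)), (∀ Q ∈ T, Q ∈ B.cubes) →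
      ∑ Q ∈ T, G Q ^ (q / p) ≤ M ^ (q / p) * (∫⁻ x in Ω, ‖fderiv ℝ u x‖ₑ ^ p) ^ (q / p) := by
    intro T hT
    refine (ENNReal.sum_rpow_le_rpow_sum T G hs).trans ?_
    rw [← ENNReal.mul_rpow_of_nonneg _ _ hs0]
    exact ENNReal.rpow_le_rpow (hW.sum_setLIntegral_le hδ hδ' hk hΛ T hT hfm) hs0
  have hGt : ∀ Q ∈ B.cubes, G Q ^ (q / p) ≠ ⊤ := fun Q hQ => by
    refine ne_top_of_le_ne_top ?_ (le_of_eq_of_le (Finset.sum_singleton (fun Q => G Q ^ (q / p)) Q).symm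
      (hGsum {Q} (by simpa using hQ)))
    exact ENNReal.mul_ne_top (ENNReal.rpow_ne_top_of_nonneg hs0 ENNReal.ofReal_ne_top)
      (ENNReal.rpow_ne_top_of_nonneg hs0 hfin)
  have hIt : ∀ Q ∈ B.cubes, I Q ≠ ⊤ := fun Q hQ =>
    ENNReal.mul_ne_top (ENNReal.mul_ne_top hC₁ (ENNReal.rpow_ne_top_of_ne_zero (hr0 Q hQ) (hrt Q)))
      (hGt Q hQ)
  have hrI : ∀ Q ∈ B.cubes, r Q ^ n * I Q = C₁ * r Q ^ (-γ) * G Q ^ (q / p) := fun Q hQ => by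
    have : r Q ^ (-γ) = r Q ^ n * r Q ^ (-γ - n) := by
      rw [← ENNReal.rpow_natCast, ← ENNReal.rpow_add _ _ (hr0 Q hQ) (hrt Q)]
      congr 1
      ring
    rw [this]
    ring
  have hmI : ∀ Q ∈ B.cubes, wMass w Q * I Q ≤ κ * 2 ^ n * C₁ * G Q ^ (q / p) := fun Q hQ => by
    calc wMass w Q * I Q ≤ κ * 2 ^ n * r Q ^ (γ + n) * I Q :=
          mul_le_mul_left (hW.wMass_le hδ hk hγ hQ) _
      _ = κ * 2 ^ n * C₁ * (r Q ^ (γ + n) * r Q ^ (-γ - n)) * G Q ^ (q / p) := by ring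
      _ = _ := by
        rw [← ENNReal.rpow_add _ _ (hr0 Q hQ) (hrt Q), show γ + n + (-γ - n) = 0 by ring,
          ENNReal.rpow_zero, mul_one]
  have hosc : ∀ Q ∈ B.cubes, ∫⁻ z in Q, ‖u z - c Q‖ₑ ^ q * ENNReal.ofReal (w z) ≤
      κ * C₁ * G Q ^ (q / p) := fun Q hQ => by
    have hκr : κ * r Q ^ γ ≠ ⊤ :=
      ENNReal.mul_ne_top hκt (ENNReal.rpow_ne_top_of_ne_zero (hr0 Q hQ) (hrt Q))
    calc ∫⁻ z in Q, ‖u z - c Q‖ₑ ^ q * ENNReal.ofReal (w z)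
        ≤ ∫⁻ z in Q, κ * r Q ^ γ * ‖u z - c Q‖ₑ ^ q := by
          refine setLIntegral_mono' (B.measurableSet hQ) fun z hz => ?_
          rw [mul_comm]
          exact mul_le_mul_left (hW.ofReal_infDist_rpow_le hδ hk hγ hQ hz) _
      _ = κ * r Q ^ γ * ∫⁻ z in Q, ‖u z - c Q‖ₑ ^ q := lintegral_const_mul' _ _ hκr
      _ ≤ κ * r Q ^ γ * (C₁ * r Q ^ (-γ) * G Q ^ (q / p)) := by
          refine mul_le_mul_right (le_trans (lintegral_mono_set ?_) (hc Q hQ)) _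
          refine (B.eq_cube Q hQ).subset.trans (cubeC_subset_cubeC _ ?_)
          exact le_mul_of_one_le_left (B.radius_pos Q hQ).le (by linarith)
      _ = κ * C₁ * (r Q ^ γ * r Q ^ (-γ)) * G Q ^ (q / p) := by ring
      _ = _ := by
        rw [← ENNReal.rpow_add _ _ (hr0 Q hQ) (hrt Q), add_neg_cancel, ENNReal.rpow_zero, mul_one]
  set a : Set (Rn n) → ℝ≥0∞ := fun Q => (A * I Q) ^ (1 / q) with ha
  have haq : ∀ Q, a Q ^ q = A * I Q := fun Q => by
    rw [ha, ← ENNReal.rpow_mul, one_div_mul_cancel hq0.ne', ENNReal.rpow_one]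
  have hlink : ∀ P ∈ B.cubes, ∀ Q ∈ B.cubes, ChainLink B.toWhitneyDecomp cdim P Q →
      edist (c P) (c Q) ≤ a P + a Q := by
    rintro P hP Q hQ ⟨z, ρ, hρ, hsub, -⟩
    have hz := hsub (mem_cubeC_self z hρ)
    have h := hW.edist_rpow_le hδ hk hΛ hq1.le hcont (c := c) (I := I)
      (fun R hR => (hc R hR).trans_eq (hrI R hR).symm) hP hQ hz.1 hz.2
    calc edist (c P) (c Q) = (edist (c P) (c Q) ^ q) ^ (1 / q) := by
          rw [← ENNReal.rpow_mul, mul_one_div_cancel hq0.ne', ENNReal.rpow_one]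
      _ ≤ (A * I P + A * I Q) ^ (1 / q) := by
          rw [← mul_add]
          exact ENNReal.rpow_le_rpow h (by positivity)
      _ ≤ _ := ENNReal.rpow_add_le_add_rpow _ _ (by positivity) ((div_le_one hq0).2 hq1.le)
  have hchain : ∀ Q ∈ B.cubes, edist (c B.central) (c Q) ≤ 2 * ((B.chain Q).map a).sum := by
    intro Q hQ
    obtain ⟨h1, -, h3, h4, h5⟩ := B.chain_isChain Q hQ
    exact le_self_add.trans (edist_le_two_mul_sum_of_isChain hlink _ h1 h5 _ _ h3 h4)
  refine ⟨c B.central, B.setLIntegral_le_of_forall_finset_sum_le fun F hF => ?_⟩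
  set T : Finset (Set (Rn n)) := F ∪ F.biUnion fun Q => (B.chain Q).toFinset with hTdef
  have hT : ∀ R ∈ T, R ∈ B.cubes := fun R hR => by
    rcases Finset.mem_union.1 hR with h | h
    · exact hF R h
    · obtain ⟨Q, hQ, hRQ⟩ := Finset.mem_biUnion.1 h
      exact (B.chain_isChain Q (hF Q hQ)).1 R (List.mem_toFinset.1 hRQ)
  have hFT : ∀ Q ∈ F, ∀ R ∈ B.chain Q, R ∈ T := fun Q hQ R hR =>
    Finset.mem_union_right _ (Finset.mem_biUnion.2 ⟨Q, hQ, List.mem_toFinset.2 hR⟩)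
  have hboman := B.sum_wMass_mul_chain_sum_le hdoub hD hN hn hj hq1
    (fun Q hQ => hW.wMass_ne_zero hδ hk hQ) (fun Q hQ => hW.wMass_ne_top hδ hk hγ hQ) hF hT hFT
    (a := a) fun R hR => ENNReal.rpow_ne_top_of_nonneg (by positivity)
      (ENNReal.mul_ne_top hAt (hIt R (hT R hR)))
  have hcube : ∀ Q ∈ F, ∫⁻ z in Q, ‖u z - c B.central‖ₑ ^ q * ENNReal.ofReal (w z) ≤
      2 ^ (q - 1) * (κ * C₁ * G Q ^ (q / p) +
        2 ^ q * (wMass w Q * ((B.chain Q).map a).sum ^ q)) := by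
    intro Q hQ
    have hQc := hF Q hQ
    have h2 : (2 : ℝ≥0∞) ^ (q - 1) ≠ ⊤ := ENNReal.rpow_ne_top_of_nonneg (by linarith) (by norm_num)
    calc ∫⁻ z in Q, ‖u z - c B.central‖ₑ ^ q * ENNReal.ofReal (w z)
        ≤ ∫⁻ z in Q, 2 ^ (q - 1) * (‖u z - c Q‖ₑ ^ q * ENNReal.ofReal (w z) +
            edist (c B.central) (c Q) ^ q * ENNReal.ofReal (w z)) := by
          refine lintegral_mono fun z => ?_
          rw [← add_mul, ← mul_assoc, edist_eq_enorm_sub]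
          exact mul_le_mul_left (enorm_sub_rpow_le_two_rpow_mul hq1.le _ _ _) _
      _ = 2 ^ (q - 1) * ((∫⁻ z in Q, ‖u z - c Q‖ₑ ^ q * ENNReal.ofReal (w z)) +
            edist (c B.central) (c Q) ^ q * wMass w Q) := by
          rw [lintegral_const_mul' _ _ h2, lintegral_add_right _ (hwm.const_mul _),
            lintegral_const_mul _ hwm]
          rfl
      _ ≤ _ := by
          refine mul_le_mul_right (add_le_add (hosc Q hQc) ?_) _
          rw [mul_comm, mul_left_comm, ← ENNReal.mul_rpow_of_nonneg _ _ hq0.le]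
          exact mul_le_mul_right (ENNReal.rpow_le_rpow (hchain Q hQc) hq0.le) _
  set J := (∫⁻ x in Ω, ‖fderiv ℝ u x‖ₑ ^ p) ^ (q / p) with hJ
  calc ∑ Q ∈ F, ∫⁻ z in Q, ‖u z - c B.central‖ₑ ^ q * ENNReal.ofReal (w z)
      ≤ ∑ Q ∈ F, 2 ^ (q - 1) * (κ * C₁ * G Q ^ (q / p) +
        2 ^ q * (wMass w Q * ((B.chain Q).map a).sum ^ q)) := Finset.sum_le_sum hcube
    _ = 2 ^ (q - 1) * (κ * C₁ * ∑ Q ∈ F, G Q ^ (q / p) +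
        2 ^ q * ∑ Q ∈ F, wMass w Q * ((B.chain Q).map a).sum ^ q) := by
        simp only [Finset.mul_sum, Finset.sum_add_distrib, mul_add]
    _ ≤ 2 ^ (q - 1) * (κ * C₁ * (M ^ (q / p) * J) +
        2 ^ q * (b * ∑ R ∈ T, wMass w R * a R ^ q)) := by
        refine mul_le_mul_right (add_le_add (mul_le_mul_right (hGsum F hF) _)
          (mul_le_mul_right hboman _)) _
    _ ≤ 2 ^ (q - 1) * (κ * C₁ * (M ^ (q / p) * J) +
        2 ^ q * (b * ∑ R ∈ T, A * (κ * 2 ^ n * C₁ * G R ^ (q / p)))) := by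
        refine mul_le_mul_right (add_le_add le_rfl (mul_le_mul_right (mul_le_mul_right
          (Finset.sum_le_sum fun R hR => ?_) _) _)) _
        rw [haq, mul_left_comm]
        exact mul_le_mul_right (hmI R (hT R hR)) _
    _ ≤ 2 ^ (q - 1) * (κ * C₁ * (M ^ (q / p) * J) +
        2 ^ q * (b * (A * (κ * 2 ^ n * C₁ * (M ^ (q / p) * J))))) := by
        rw [← Finset.mul_sum, ← Finset.mul_sum]
        gcongr
        exact hGsum T hT
    _ = _ := by ring

end

/-- distance-to-boundary weight in a Boman domain: let
`1 < p ≤ q ≤ np/(n−p) < ∞`, `β = n − (q/p)(n−p)`, and let `Ω ⊆ ℝ^n` be a bounded Boman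
domain with constant `N` such that `w(x) = d(x,∂Ω)^{−β}` is doubling in `Ω` with constant
`D`. Then there is `C = C(n, p, q, D, N) > 0` such that for every `u ∈ Lip_loc(Ω)`,
`inf_c (∫_Ω |u − c|^q d(x,∂Ω)^{−β} dx)^{1/q} ≤ C (∫_Ω |∇u|^p dx)^{1/p}`. -/
theorem distance_to_boundary_weight_poincare
    (n : ℕ) (p q D N Cdim cdim : ℝ) (hp : 1 < p) (hpq : p ≤ q) (hpn : p < n)
    (hq : q ≤ n * p / (n - p)) (hD : 0 < D) (hN : 1 ≤ N) :
    ∃ C : ℝ, 0 < C ∧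
      ∀ Ω : Set (Rn n), IsOpen Ω → IsConnected Ω → Bornology.IsBounded Ω →
      ∀ _B : BomanDecomp n Ω Cdim cdim N,
        DoublingIn Ω
          (fun x => Metric.infDist x (frontier Ω) ^ (-(n : ℝ) + q / p * (n - p))) D →
      ∀ u : Rn n → ℝ,
        (∀ Kc : Set (Rn n), Kc ⊆ Ω → IsCompact Kc → ∃ L : ℝ≥0, LipschitzOnWith L u Kc) →
        (⨅ c : ℝ, ∫⁻ x in Ω, (ENNReal.ofReal |u x - c|) ^ q *
            ENNReal.ofReal (Metric.infDist x (frontier Ω) ^ (-(n : ℝ) + q / p * (n - p)))) ^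
              (1 / q) ≤
          ENNReal.ofReal C * (∫⁻ x in Ω, (ENNReal.ofReal ‖fderiv ℝ u x‖) ^ p) ^ (1 / p) := by
  rcases le_or_gt Cdim 0 with hCdim | hCdim
  · exact ⟨1, one_pos, fun Ω _ _ _ B => absurd (B.pos_of_mem B.central_mem) hCdim.not_gt⟩
  obtain ⟨C, hC, h⟩ := exists_weighted_poincare n (Cdim := Cdim) cdim hp hpq hpn hq hD hN hCdim
  have hp0 : 0 < p := by linarith
  have hq0 : 0 < q := by linarith
  refine ⟨(C ^ (1 / q)).toReal + 1, by positivity, fun Ω hΩ _ _ B hw u hu => ?_⟩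
  have hpos : (0 : ℝ) < (C ^ (1 / q)).toReal + 1 := by positivity
  simp only [← Real.enorm_eq_ofReal_abs, ofReal_norm]
  by_cases hfin : ∫⁻ x in Ω, ‖fderiv ℝ u x‖ₑ ^ p = ⊤
  · rw [hfin, ENNReal.top_rpow_of_pos (by positivity),
      ENNReal.mul_top (ENNReal.ofReal_pos.2 hpos).ne']
    exact le_top
  obtain ⟨c, hc⟩ := h Ω hΩ B hw u hu hfin
  calc _ ≤ (C * (∫⁻ x in Ω, ‖fderiv ℝ u x‖ₑ ^ p) ^ (q / p)) ^ (1 / q) :=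
        ENNReal.rpow_le_rpow ((iInf_le _ c).trans hc) (by positivity)
    _ = C ^ (1 / q) * (∫⁻ x in Ω, ‖fderiv ℝ u x‖ₑ ^ p) ^ (1 / p) := by
        rw [ENNReal.mul_rpow_of_nonneg _ _ (by positivity), ← ENNReal.rpow_mul]
        congr 2
        field_simp
    _ ≤ _ := by
        refine mul_le_mul_left ?_ _
        have ht : C ^ (1 / q) ≠ ⊤ := ENNReal.rpow_ne_top_of_nonneg (by positivity) hC
        rw [← ENNReal.ofReal_toReal ht, ENNReal.toReal_ofReal ENNReal.toReal_nonneg]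
        exact ENNReal.ofReal_le_ofReal (by linarith)
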